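/- Let M be a compact connected n-manifold without boundary and let μ and ν be good Radon measures on M with μ(M) = ν(M). Then there exists h ∈ 𝓗(M)₀ with h_*μ = ν. -/

import Mathlib

open MeasureTheory TopologicalSpace

/-- The set of homeomorphisms of `M`, as a subset of `C(M, M)` (compact-open topology). -/
def HomeoSet (M : Type*) [TopologicalSpace M] : Set C(M, M) :=
  {f | IsHomeomorph f}

/-- The identity component `𝓗(M)₀` of the homeomorphism group of `M`. -/
def HomeoIdComp (M : Type*) [TopologicalSpace M] : Set C(M, M) :=
  connectedComponentIn (HomeoSet M) (ContinuousMap.id M)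

/-- The logit coordinate on the interval `(a, b)`. -/
noncomputable def intervalLogit (a b u : ℝ) : ℝ := Real.log ((u - a) / (b - u))

/-- A flow on `ℝ` with time parameter `p`, which is a translation in the logit coordinate of
`(a, b)` and fixes every point outside `(a, b)`. -/
noncomputable def slide (a b u p : ℝ) : ℝ :=
  u - max a (min b u) + (a * (b - max a (min b u)) + b * (max a (min b u) - a) * Real.exp p) /
    ((b - max a (min b u)) + (max a (min b u) - a) * Real.exp p)

lemma intervalLogit_strictMonoOn (a b : ℝ) :
    StrictMonoOn (intervalLogit a b) (Set.Ioo a b) := by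
  intro u hu v hv huv
  unfold intervalLogit
  apply Real.log_lt_log
  · exact div_pos (by linarith [hu.1]) (by linarith [hu.2])
  · rw [div_lt_div_iff₀ (by linarith [hu.2]) (by linarith [hv.2])]
    nlinarith [hu.1, hu.2, hv.1, hv.2]

lemma continuous_slide {a b : ℝ} (hab : a < b) :
    Continuous (fun z : ℝ × ℝ => slide a b z.1 z.2) := by
  unfold slide
  refine Continuous.add (by fun_prop) (Continuous.div (by fun_prop) (by fun_prop) ?_)
  rintro ⟨u, p⟩
  have h1 : a ≤ max a (min b u) := le_max_left _ _
  have h2 : max a (min b u) ≤ b := max_le hab.le (min_le_left _ _)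
  have h3 := Real.exp_pos p
  rcases h2.lt_or_eq with h | h
  · have : 0 ≤ (max a (min b u) - a) * Real.exp p := mul_nonneg (by linarith) h3.le
    dsimp only
    linarith
  · dsimp only
    rw [h]
    have : 0 < (b - a) * Real.exp p := mul_pos (by linarith) h3
    linarith

lemma slide_of_notMem {a b u : ℝ} (hab : a < b) (hu : u ∉ Set.Ioo a b) (p : ℝ) :
    slide a b u p = u := by
  unfold slide
  have hp := Real.exp_pos p
  rcases le_or_gt u a with h | h
  · rw [max_eq_left ((min_le_right _ _).trans h)]
    have : b - a ≠ 0 := by linarith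
    simp [this]
  · have hbu : b ≤ u := by
      by_contra hb
      exact hu ⟨h, not_le.1 hb⟩
    rw [min_eq_left hbu, max_eq_right hab.le]
    have : b - a ≠ 0 := by linarith
    field_simp
    ring

lemma slide_of_mem {a b u : ℝ} (hu : u ∈ Set.Ioo a b) (p : ℝ) :
    slide a b u p ∈ Set.Ioo a b ∧
      intervalLogit a b (slide a b u p) = intervalLogit a b u + p := by
  obtain ⟨h1, h2⟩ := hu
  have hp := Real.exp_pos p
  have hd : 0 < (b - u) + (u - a) * Real.exp p :=
    add_pos (by linarith) (mul_pos (by linarith) hp)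
  have hs : slide a b u p =
      (a * (b - u) + b * (u - a) * Real.exp p) / ((b - u) + (u - a) * Real.exp p) := by
    unfold slide
    rw [min_eq_right h2.le, max_eq_right h1.le]
    ring
  have e1 : slide a b u p - a =
      (b - a) * ((u - a) * Real.exp p) / ((b - u) + (u - a) * Real.exp p) := by
    rw [hs]; field_simp; ring
  have e2 : b - slide a b u p = (b - a) * (b - u) / ((b - u) + (u - a) * Real.exp p) := by
    rw [hs]; field_simp; ring
  have hba : 0 < b - a := by linarith
  have hua : 0 < u - a := by linarith
  have hbu : 0 < b - u := by linarith
  have p1 : 0 < slide a b u p - a := by rw [e1]; positivity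
  have p2 : 0 < b - slide a b u p := by rw [e2]; positivity
  refine ⟨⟨by linarith, by linarith⟩, ?_⟩
  unfold intervalLogit
  have : (slide a b u p - a) / (b - slide a b u p) = (u - a) / (b - u) * Real.exp p := by
    rw [e1, e2]; field_simp
  rw [this, Real.log_mul (by positivity) hp.ne', Real.log_exp]

lemma slide_zero {a b : ℝ} (hab : a < b) (u : ℝ) : slide a b u 0 = u := by
  by_cases hu : u ∈ Set.Ioo a b
  · obtain ⟨h1, h2⟩ := slide_of_mem hu 0
    exact (intervalLogit_strictMonoOn a b).injOn h1 hu (by simpa using h2)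
  · exact slide_of_notMem hab hu 0

lemma slide_slide_neg {a b : ℝ} (hab : a < b) (u p : ℝ) :
    slide a b (slide a b u p) (-p) = u := by
  by_cases hu : u ∈ Set.Ioo a b
  · obtain ⟨h1, h2⟩ := slide_of_mem hu p
    obtain ⟨h3, h4⟩ := slide_of_mem h1 (-p)
    exact (intervalLogit_strictMonoOn a b).injOn h3 hu (by rw [h4, h2]; ring)
  · rw [slide_of_notMem hab hu, slide_of_notMem hab hu]

/-- The homeomorphism sliding the `i`-th coordinate for a time `q` that does not depend on that
coordinate. -/
noncomputable def shear {n : ℕ} (i : Fin n) {a b : ℝ} (hab : a < b) (q : (Fin n → ℝ) → ℝ)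
    (hq : Continuous q) (hqi : ∀ x y, q (Function.update x i y) = q x) :
    (Fin n → ℝ) ≃ₜ (Fin n → ℝ) where
  toFun x := Function.update x i (slide a b (x i) (q x))
  invFun x := Function.update x i (slide a b (x i) (-q x))
  left_inv x := by simp [hqi, slide_slide_neg hab]
  right_inv x := by
    have := slide_slide_neg hab (x i) (-q x)
    rw [neg_neg] at this
    simp [hqi, this]
  continuous_toFun := continuous_id.update i
    ((continuous_slide hab).comp ((continuous_apply i).prodMk hq))
  continuous_invFun := continuous_id.update i
    ((continuous_slide hab).comp ((continuous_apply i).prodMk hq.neg))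

lemma exists_measure_Ioi_eq (ρ : Measure ℝ) [IsFiniteMeasure ρ] (h0 : ∀ s, ρ {s} = 0)
    {r : ENNReal} (hr0 : 0 < r) (hr : r < ρ Set.univ) : ∃ s, ρ (Set.Ioi s) = r := by
  have hne : r ≠ ⊤ := (hr.trans_le le_top).ne
  set S : Set ℝ := {s | r ≤ ρ (Set.Ici s)} with hS
  have hSne : S.Nonempty := by
    obtain ⟨s, hs⟩ := ((tendsto_measure_Ici_atBot ρ).eventually (lt_mem_nhds hr)).exists
    exact ⟨s, hs.le⟩
  have hSb : BddAbove S := by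
    have h1 : ρ Set.univ - r < ρ Set.univ :=
      ENNReal.sub_lt_self (measure_ne_top _ _) (hr0.trans hr).ne' hr0.ne'
    obtain ⟨K, hK⟩ := ((tendsto_measure_Iic_atTop ρ).eventually (lt_mem_nhds h1)).exists
    refine ⟨K, fun s hs => ?_⟩
    by_contra hKs
    have h2 : ρ (Set.Iic K) + ρ (Set.Ici s) ≤ ρ Set.univ := by
      rw [← measure_union _ measurableSet_Ici]
      · exact measure_mono (Set.subset_univ _)
      · rw [Set.disjoint_left]
        intro x hx hx'
        exact hKs (le_trans hx' hx)
    have h3 : ρ Set.univ < ρ (Set.Iic K) + r := by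
      rw [add_comm]; exact ENNReal.lt_add_of_sub_lt_left (Or.inr hne) hK
    exact absurd (h3.trans_le (add_le_add le_rfl hs)) h2.not_gt
  refine ⟨sSup S, ?_⟩
  have hIci : ρ (Set.Ioi (sSup S)) = ρ (Set.Ici (sSup S)) := by
    refine le_antisymm (measure_mono Set.Ioi_subset_Ici_self) ?_
    rw [← Set.Ioi_union_left]
    refine (measure_union_le _ _).trans ?_
    rw [h0, add_zero]
  apply le_antisymm
  · obtain ⟨u, hu, hu1, hu2⟩ := exists_seq_strictAnti_tendsto (sSup S)
    have : Set.Ioi (sSup S) = ⋃ k, Set.Ici (u k) :=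
      (iUnion_Ici_eq_Ioi_of_lt_of_tendsto hu1 hu2).symm
    rw [this, Monotone.measure_iUnion]
    · refine iSup_le fun k => ?_
      by_contra hk
      exact absurd (le_csSup hSb (not_le.1 hk).le) (hu1 k).not_ge
    · exact fun i j hij => Set.Ici_subset_Ici.2 (hu.antitone hij)
  · rw [hIci]
    obtain ⟨u, hu, hu1, hu2⟩ := exists_seq_strictMono_tendsto (sSup S)
    have : Set.Ici (sSup S) = ⋂ k, Set.Ici (u k) := by
      ext x
      simp only [Set.mem_Ici, Set.mem_iInter]
      exact ⟨fun h k => (hu1 k).le.trans h, fun h => le_of_tendsto' hu2 h⟩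
    rw [this, Antitone.measure_iInter]
    · refine le_iInf fun k => ?_
      obtain ⟨s, hs, hks⟩ := exists_lt_of_lt_csSup hSne (hu1 k)
      exact le_trans hs (measure_mono (Set.Ici_subset_Ici.2 hks.le))
    · exact fun i j hij => Set.Ici_subset_Ici.2 (hu.monotone hij)
    · exact fun k => measurableSet_Ici.nullMeasurableSet
    · exact ⟨0, measure_ne_top _ _⟩

/-- A parametrized family of functions which separates any two points of `B` for almost every
parameter has, for some parameter, only null level sets in `B`. -/
lemma exists_forall_measure_level_eq_zero {X : Type*} [MeasurableSpace X] [MeasurableEq X]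
    (α : Measure X) [IsFiniteMeasure α] (hα : ∀ p, α {p} = 0) {B : Set X} (hB : MeasurableSet B)
    (T : ℝ → X → ℝ) (hT : Measurable (fun z : ℝ × X => T z.1 z.2))
    (hsep : ∀ x ∈ B, ∀ y ∈ B, x ≠ y → volume {t | T t x = T t y} = 0) :
    ∃ t, ∀ s, α (B ∩ {x | T t x = s}) = 0 := by
  have hdiag : α.prod α (Set.diagonal X) = 0 := by
    rw [Measure.measure_prod_null measurableSet_diagonal]
    refine Filter.Eventually.of_forall fun x => ?_
    have : Prod.mk x ⁻¹' Set.diagonal X = {x} := by ext y; simp [eq_comm]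
    simpa [this] using hα x
  have key : ∀ᵐ z ∂(α.prod α), ∀ᵐ t : ℝ, ¬ (z.1 ∈ B ∧ z.2 ∈ B ∧ T t z.1 = T t z.2) := by
    have hz : ∀ᵐ z ∂(α.prod α), z ∉ Set.diagonal X := measure_eq_zero_iff_ae_notMem.1 hdiag
    filter_upwards [hz] with z hz
    by_cases hz1 : z.1 ∈ B
    · by_cases hz2 : z.2 ∈ B
      · refine (measure_eq_zero_iff_ae_notMem.1 (hsep z.1 hz1 z.2 hz2 hz)).mono fun t ht h => ?_
        exact ht h.2.2
      · exact Filter.Eventually.of_forall fun t h => hz2 h.2.1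
    · exact Filter.Eventually.of_forall fun t h => hz1 h.1
  rw [Measure.ae_ae_comm] at key
  · obtain ⟨t, ht⟩ := key.exists
    refine ⟨t, fun s => ?_⟩
    have h1 : α.prod α ((B ∩ {x | T t x = s}) ×ˢ (B ∩ {x | T t x = s})) = 0 := by
      refine measure_mono_null ?_ ht
      rintro ⟨x, y⟩ ⟨⟨hx, hx'⟩, hy, hy'⟩
      simp only [Set.mem_ofPred_eq] at hx' hy'
      simp [hx, hy, hx', hy']
    rw [Measure.prod_prod] at h1
    exact mul_self_eq_zero.1 h1
  · apply MeasurableSet.compl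
    have m1 : Measurable (fun z : (X × X) × ℝ => T z.2 z.1.1) :=
      hT.comp (measurable_snd.prodMk (measurable_fst.comp measurable_fst))
    have m2 : Measurable (fun z : (X × X) × ℝ => T z.2 z.1.2) :=
      hT.comp (measurable_snd.prodMk (measurable_snd.comp measurable_fst))
    exact ((measurable_fst.comp measurable_fst) hB).inter
      (((measurable_snd.comp measurable_fst) hB).inter (measurableSet_eq_fun m1 m2))

/-- For distinct points `x`, `y` separated by `τ` whenever they differ in the coordinate `i`
only, a generic point of the moment curve gives a perturbation of `τ` separating `x` and `y`. -/
lemma volume_moment_level_eq_zero {n : ℕ} (i : Fin n) (x y : Fin n → ℝ) (τx τy : ℝ)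
    (h : (∀ j, j ≠ i → x j = y j) → τx ≠ τy) :
    volume {t : ℝ | τx - ∑ j ∈ Finset.univ.erase i, t ^ (j.val + 1) * x j =
      τy - ∑ j ∈ Finset.univ.erase i, t ^ (j.val + 1) * y j} = 0 := by
  set P : Polynomial ℝ := Polynomial.C (τx - τy) -
    ∑ j ∈ Finset.univ.erase i, Polynomial.C (x j - y j) * Polynomial.X ^ (j.val + 1) with hP
  have hP0 : P ≠ 0 := by
    intro h0
    have hj : ∀ j, j ≠ i → x j = y j := by
      intro j hj
      have h1 := congrArg (fun Q => Polynomial.coeff Q (j.val + 1)) h0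
      simp only [hP, Polynomial.coeff_sub, Polynomial.finsetSum_coeff,
        Polynomial.coeff_C_mul, Polynomial.coeff_X_pow, Polynomial.coeff_zero,
        Polynomial.coeff_C_succ, zero_sub, neg_eq_zero] at h1
      rw [Finset.sum_eq_single j] at h1
      · simp at h1; linarith
      · intro k _ hkj
        have : j.val + 1 ≠ k.val + 1 := fun hh => hkj (Fin.ext (by omega))
        rw [if_neg this, mul_zero]
      · intro hh
        exact absurd (Finset.mem_erase.2 ⟨hj, Finset.mem_univ _⟩) hh
    apply h hj
    have h1 := congrArg (fun Q => Polynomial.eval 0 Q) h0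
    simp [hP, Polynomial.eval_finsetSum] at h1
    linarith
  refine measure_mono_null ?_ (Polynomial.finite_setOfPred_isRoot hP0 |>.measure_zero volume)
  intro t ht
  simp only [Set.mem_ofPred_eq, Polynomial.IsRoot.def] at ht ⊢
  simp only [hP, Polynomial.eval_sub, Polynomial.eval_C, Polynomial.eval_finsetSum,
    Polynomial.eval_mul, Polynomial.eval_pow, Polynomial.eval_X]
  have : ∑ j ∈ Finset.univ.erase i, (x j - y j) * t ^ (j.val + 1) =
      ∑ j ∈ Finset.univ.erase i, t ^ (j.val + 1) * x j -
        ∑ j ∈ Finset.univ.erase i, t ^ (j.val + 1) * y j := by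
    rw [← Finset.sum_sub_distrib]
    exact Finset.sum_congr rfl fun j _ => by ring
  rw [this]
  linarith

/-- The open box with corners `a` and `b`. -/
def openBox {n : ℕ} (a b : Fin n → ℝ) : Set (Fin n → ℝ) :=
  Set.pi Set.univ fun i => Set.Ioo (a i) (b i)

lemma mem_openBox {n : ℕ} {a b x : Fin n → ℝ} :
    x ∈ openBox a b ↔ ∀ i, x i ∈ Set.Ioo (a i) (b i) := by
  simp [openBox]

lemma isOpen_openBox {n : ℕ} (a b : Fin n → ℝ) : IsOpen (openBox a b) :=
  isOpen_set_pi Set.finite_univ fun _ _ => isOpen_Ioo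

lemma openBox_nonempty {n : ℕ} {a b : Fin n → ℝ} (hab : ∀ i, a i < b i) :
    (openBox a b).Nonempty :=
  ⟨fun i => (a i + b i) / 2, mem_openBox.2 fun i =>
    ⟨by have := hab i; linarith, by have := hab i; linarith⟩⟩

lemma openBox_update_right {n : ℕ} {a b : Fin n → ℝ} {i : Fin n} {c : ℝ} (hc : c < b i) :
    openBox a (Function.update b i c) = openBox a b ∩ {x | x i < c} := by
  ext x
  simp only [mem_openBox, Set.mem_inter_iff, Set.mem_ofPred_eq]
  constructor
  · intro h
    have hi := h i
    simp only [Function.update_self] at hi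
    refine ⟨fun j => ?_, hi.2⟩
    by_cases hj : j = i
    · subst hj; exact ⟨hi.1, hi.2.trans hc⟩
    · simpa [hj] using h j
  · rintro ⟨h, hi⟩ j
    by_cases hj : j = i
    · subst hj; simpa using ⟨(h j).1, hi⟩
    · simpa [hj] using h j

lemma openBox_update_left {n : ℕ} {a b : Fin n → ℝ} {i : Fin n} {c : ℝ} (hc : a i < c) :
    openBox (Function.update a i c) b = openBox a b ∩ {x | c < x i} := by
  ext x
  simp only [mem_openBox, Set.mem_inter_iff, Set.mem_ofPred_eq]
  constructor
  · intro h
    have hi := h i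
    simp only [Function.update_self] at hi
    refine ⟨fun j => ?_, hi.1⟩
    by_cases hj : j = i
    · subst hj; exact ⟨hc.trans hi.1, hi.2⟩
    · simpa [hj] using h j
  · rintro ⟨h, hi⟩ j
    by_cases hj : j = i
    · subst hj; simpa using ⟨hi, (h j).2⟩
    · simpa [hj] using h j

lemma exists_measure_slice_eq_zero {n : ℕ} (β : Measure (Fin n → ℝ)) [IsFiniteMeasure β]
    (i : Fin n) {u v : ℝ} (huv : u < v) : ∃ c ∈ Set.Ioo u v, β {x | x i = c} = 0 := by
  have hcount : Set.Countable {c : ℝ | 0 < β {x | x i = c}} := by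
    apply Measure.countable_meas_pos_of_disjoint_iUnion
    · intro c
      exact measurableSet_eq_fun (measurable_pi_apply i) measurable_const
    · intro c d hcd
      rw [Function.onFun, Set.disjoint_left]
      intro x hx hx'
      exact hcd (hx.symm.trans hx')
  by_contra! h
  have : Set.Ioo u v ⊆ {c : ℝ | 0 < β {x | x i = c}} := fun c hc => pos_iff_ne_zero.2 (h c hc)
  exact absurd (Cardinal.Real.Ioo_countable_iff.1 (hcount.mono this)) huv.not_ge

lemma exists_split_openBox {n : ℕ} (i : Fin n) {a b : Fin n → ℝ} (hab : ∀ j, a j < b j)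
    (α β : Measure (Fin n → ℝ)) [IsFiniteMeasure α] [IsFiniteMeasure β] (hα : ∀ p, α {p} = 0)
    (hβ : ∀ O, IsOpen O → O.Nonempty → O ⊆ openBox a b → 0 < β O)
    (heq : α (openBox a b) = β (openBox a b)) :
    ∃ c ∈ Set.Ioo ((2 * a i + b i) / 3) ((a i + 2 * b i) / 3),
      ∃ f : (Fin n → ℝ) ≃ₜ (Fin n → ℝ), (∀ x ∉ openBox a b, f x = x) ∧
        α.map f (openBox a (Function.update b i c)) = β (openBox a (Function.update b i c)) ∧
        α.map f (openBox (Function.update a i c) b) = β (openBox (Function.update a i c) b) ∧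
        α.map f (openBox a b \ (openBox a (Function.update b i c) ∪
          openBox (Function.update a i c) b)) = 0 ∧
        β (openBox a b \ (openBox a (Function.update b i c) ∪
          openBox (Function.update a i c) b)) = 0 := by
  have habi := hab i
  obtain ⟨c, hc, hβc⟩ := exists_measure_slice_eq_zero β i
    (show (2 * a i + b i) / 3 < (a i + 2 * b i) / 3 by linarith)
  have hac : a i < c := by linarith [hc.1]
  have hcb : c < b i := by linarith [hc.2]
  refine ⟨c, hc, ?_⟩
  rw [openBox_update_right hcb, openBox_update_left hac]
  set B := openBox a b with hB
  have hBm : MeasurableSet B := (isOpen_openBox a b).measurableSet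
  have hdiff : B \ (B ∩ {x | x i < c} ∪ B ∩ {x | c < x i}) = B ∩ {x | x i = c} := by
    ext x
    simp only [Set.mem_sdiff, Set.mem_union, Set.mem_inter_iff, Set.mem_ofPred_eq]
    constructor
    · rintro ⟨h1, h2⟩
      push Not at h2
      exact ⟨h1, le_antisymm (h2.2 h1) (h2.1 h1)⟩
    · rintro ⟨h1, h2⟩
      exact ⟨h1, by simp [h2]⟩
  rw [hdiff]
  have mlt : MeasurableSet {x : Fin n → ℝ | x i < c} :=
    measurableSet_lt (measurable_pi_apply i) measurable_const
  have mgt : MeasurableSet {x : Fin n → ℝ | c < x i} :=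
    measurableSet_lt measurable_const (measurable_pi_apply i)
  have meq : MeasurableSet {x : Fin n → ℝ | x i = c} :=
    measurableSet_eq_fun (measurable_pi_apply i) measurable_const
  have hsum : ∀ γ : Measure (Fin n → ℝ), γ (B ∩ {x | x i = c}) = 0 →
      γ (B ∩ {x | x i < c}) + γ (B ∩ {x | c < x i}) = γ B := by
    intro γ hγ
    rw [← measure_union _ (hBm.inter mgt)]
    · apply measure_eq_measure_of_null_sdiff (by
        rintro x (⟨h, _⟩ | ⟨h, _⟩) <;> exact h)
      rw [hdiff, hγ]
    · rw [Set.disjoint_left]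
      rintro x ⟨_, h⟩ ⟨_, h'⟩
      exact lt_asymm (show x i < c from h) h'
  have hβc' : β (B ∩ {x | x i = c}) = 0 := measure_mono_null Set.inter_subset_right hβc
  -- both halves have positive `β`-measure
  have hβL : 0 < β (B ∩ {x | x i < c}) := by
    apply hβ _ _ _ Set.inter_subset_left
    · exact (isOpen_openBox a b).inter (isOpen_lt (continuous_apply i) continuous_const)
    · rw [← openBox_update_right hcb]
      apply openBox_nonempty
      intro j
      by_cases hj : j = i
      · subst hj; simpa using hac
      · simpa [hj] using hab j
  have hβR : 0 < β (B ∩ {x | c < x i}) := by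
    apply hβ _ _ _ Set.inter_subset_left
    · exact (isOpen_openBox a b).inter (isOpen_lt continuous_const (continuous_apply i))
    · rw [← openBox_update_left hac]
      apply openBox_nonempty
      intro j
      by_cases hj : j = i
      · subst hj; simpa using hcb
      · simpa [hj] using hab j
  -- the foliation of the box by graphs over the coordinates other than `i`
  set w : (Fin n → ℝ) → ℝ := fun x =>
    ∏ j ∈ Finset.univ.erase i, max 0 ((x j - a j) * (b j - x j)) with hw
  set g : ℝ → (Fin n → ℝ) → ℝ := fun t x =>
    ∑ j ∈ Finset.univ.erase i, t ^ (j.val + 1) * x j with hg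
  set τ : (Fin n → ℝ) → ℝ := fun x =>
    (intervalLogit (a i) (b i) c - intervalLogit (a i) (b i) (x i)) / w x with hτ
  have hwpos : ∀ x ∈ B, 0 < w x := by
    intro x hx
    refine Finset.prod_pos fun j _ => ?_
    obtain ⟨h1, h2⟩ := mem_openBox.1 hx j
    exact lt_max_of_lt_right (mul_pos (by linarith) (by linarith))
  have hwcont : Continuous w := by
    refine continuous_finsetProd _ fun j _ => ?_
    fun_prop
  have hgcont : ∀ t, Continuous (g t) := by
    intro t
    refine continuous_finsetSum _ fun j _ => ?_
    fun_prop
  have hτm : Measurable τ := by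
    refine Measurable.div ?_ hwcont.measurable
    unfold intervalLogit
    fun_prop
  have hTm : Measurable (fun z : ℝ × (Fin n → ℝ) => τ z.2 - g z.1 z.2) := by
    refine (hτm.comp measurable_snd).sub ?_
    refine Continuous.measurable (continuous_finsetSum _ fun j _ => ?_)
    fun_prop
  obtain ⟨t, ht⟩ := exists_forall_measure_level_eq_zero α hα hBm (fun t x => τ x - g t x) hTm (by
    intro x hx y hy hxy
    refine volume_moment_level_eq_zero i x y (τ x) (τ y) fun hj hττ => hxy ?_
    have hwxy : w x = w y := Finset.prod_congr rfl fun j hj' => by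
      rw [hj j (Finset.ne_of_mem_erase hj')]
    simp only [hτ] at hττ
    rw [hwxy, div_left_inj' (hwpos y hy).ne'] at hττ
    have hi : x i = y i := (intervalLogit_strictMonoOn (a i) (b i)).injOn
      (mem_openBox.1 hx i) (mem_openBox.1 hy i) (by linarith)
    funext j
    by_cases hji : j = i
    · rw [hji, hi]
    · exact hj j hji)
  have hTt : Measurable (fun x => τ x - g t x) := hτm.sub (hgcont t).measurable
  -- choose the leaf cutting off the right mass
  obtain ⟨s, hs⟩ := exists_measure_Ioi_eq ((α.restrict B).map (fun x => τ x - g t x)) (by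
      intro s
      rw [Measure.map_apply hTt (measurableSet_singleton s), Measure.restrict_apply' hBm,
        Set.inter_comm]
      exact ht s) hβL (by
      rw [Measure.map_apply hTt MeasurableSet.univ, Set.preimage_univ, Measure.restrict_apply_univ,
        heq, ← hsum β hβc']
      exact ENNReal.lt_add_right (measure_ne_top _ _) hβR.ne')
  rw [Measure.map_apply hTt measurableSet_Ioi, Measure.restrict_apply' hBm] at hs
  have hqi : ∀ x y, w (Function.update x i y) * (s + g t (Function.update x i y)) =
      w x * (s + g t x) := by
    intro x y
    have h1 : w (Function.update x i y) = w x := Finset.prod_congr rfl fun j hj => by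
      rw [Function.update_of_ne (Finset.ne_of_mem_erase hj)]
    have h2 : g t (Function.update x i y) = g t x := Finset.sum_congr rfl fun j hj => by
      rw [Function.update_of_ne (Finset.ne_of_mem_erase hj)]
    rw [h1, h2]
  set f := shear i habi (fun x => w x * (s + g t x))
    (hwcont.mul (continuous_const.add (hgcont t))) hqi with hf
  have hfx : ∀ x, f x = Function.update x i (slide (a i) (b i) (x i) (w x * (s + g t x))) :=
    fun x => rfl
  have hfid : ∀ x ∉ B, f x = x := by
    intro x hx
    rw [hfx]
    rw [hB, mem_openBox] at hx
    push Not at hx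
    obtain ⟨j, hj⟩ := hx
    by_cases hji : j = i
    · subst hji
      rw [slide_of_notMem habi hj, Function.update_eq_self]
    · have : w x = 0 := by
        refine Finset.prod_eq_zero (Finset.mem_erase.2 ⟨hji, Finset.mem_univ j⟩) ?_
        apply max_eq_left
        by_contra! hpos
        rcases pos_and_pos_or_neg_and_neg_of_mul_pos hpos with h | h
        · exact hj ⟨by linarith, by linarith⟩
        · linarith [hab j]
      rw [this, zero_mul, slide_zero habi, Function.update_eq_self]
  have hfB : ∀ x ∈ B, f x ∈ B ∧
      intervalLogit (a i) (b i) (f x i) = intervalLogit (a i) (b i) (x i) + w x * (s + g t x) := by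
    intro x hx
    obtain ⟨h1, h2⟩ := slide_of_mem (mem_openBox.1 hx i) (w x * (s + g t x))
    rw [hfx]
    refine ⟨mem_openBox.2 fun j => ?_, by simpa using h2⟩
    by_cases hji : j = i
    · subst hji; simpa using h1
    · simpa [hji] using mem_openBox.1 hx j
  have hfB' : ∀ x, f x ∈ B ↔ x ∈ B := by
    intro x
    refine ⟨fun h => ?_, fun h => (hfB x h).1⟩
    by_contra hx
    rw [hfid x hx] at h
    exact hx h
  have hmono := intervalLogit_strictMonoOn (a i) (b i)
  have hpreL : f ⁻¹' (B ∩ {x | x i < c}) = (fun x => τ x - g t x) ⁻¹' Set.Ioi s ∩ B := by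
    ext x
    simp only [Set.mem_preimage, Set.mem_inter_iff, Set.mem_ofPred_eq, hfB', Set.mem_Ioi]
    rw [and_comm]
    refine and_congr_left fun hx => ?_
    rw [← hmono.lt_iff_lt (mem_openBox.1 (hfB x hx).1 i) ⟨hac, hcb⟩, (hfB x hx).2,
      lt_sub_iff_add_lt, hτ, lt_div_iff₀ (hwpos x hx), lt_sub_iff_add_lt]
    rw [add_comm, mul_comm]
  have hpreE : f ⁻¹' (B ∩ {x | x i = c}) = B ∩ {x | τ x - g t x = s} := by
    ext x
    simp only [Set.mem_preimage, Set.mem_inter_iff, Set.mem_ofPred_eq, hfB']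
    refine and_congr_right fun hx => ?_
    rw [← hmono.injOn.eq_iff (mem_openBox.1 (hfB x hx).1 i) ⟨hac, hcb⟩, (hfB x hx).2,
      sub_eq_iff_eq_add, hτ, div_eq_iff (hwpos x hx).ne']
    constructor <;> intro h <;> linarith
  have hfm : Measurable f := f.continuous.measurable
  have hE : α.map f (B ∩ {x | x i = c}) = 0 := by
    rw [Measure.map_apply hfm (hBm.inter meq), hpreE]
    exact ht s
  have hL : α.map f (B ∩ {x | x i < c}) = β (B ∩ {x | x i < c}) := by
    rw [Measure.map_apply hfm (hBm.inter mlt), hpreL, hs]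
  refine ⟨f, hfid, hL, ?_, hE, hβc'⟩
  have h1 := hsum _ hE
  have h2 : α.map f B = β B := by
    rw [Measure.map_apply hfm hBm, ← heq]
    congr 1
    ext x
    exact hfB' x
  rw [h2, ← hsum β hβc', hL] at h1
  exact (ENNReal.add_right_inj (measure_ne_top _ _)).1 h1

lemma Homeomorph.apply_mem_iff_of_eq_off {X : Type*} [TopologicalSpace X] {B : Set X} {f : X ≃ₜ X}
    (hf : ∀ x ∉ B, f x = x) (x : X) : f x ∈ B ↔ x ∈ B := by
  constructor
  · intro h
    by_contra hx
    exact hx (hf x hx ▸ h)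
  · intro h
    by_contra hx
    exact hx ((f.injective (hf _ hx)).symm ▸ h)

lemma Homeomorph.symm_apply_eq_off {X : Type*} [TopologicalSpace X] {B : Set X} {f : X ≃ₜ X}
    (hf : ∀ x ∉ B, f x = x) : ∀ x ∉ B, f.symm x = x := by
  intro x hx
  rw [Homeomorph.symm_apply_eq, hf x hx]

/-- The set `B` is cut, up to null sets for `α` and `β`, into finitely many open boxes with sides
at most `δ` on which `α` and `β` have the same mass. -/
inductive Matched {n : ℕ} (δ : ℝ) (α β : Measure (Fin n → ℝ)) : Set (Fin n → ℝ) → Prop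
  | leaf (a b : Fin n → ℝ) (hab : ∀ i, a i < b i) (hδ : ∀ i, b i - a i ≤ δ)
      (heq : α (openBox a b) = β (openBox a b)) : Matched δ α β (openBox a b)
  | node (B B₁ B₂ : Set (Fin n → ℝ)) (hB : MeasurableSet B) (h₁ : B₁ ⊆ B) (h₂ : B₂ ⊆ B)
      (hd : Disjoint B₁ B₂) (hα : α (B \ (B₁ ∪ B₂)) = 0) (hβ : β (B \ (B₁ ∪ B₂)) = 0)
      (m₁ : Matched δ α β B₁) (m₂ : Matched δ α β B₂) : Matched δ α β B

namespace Matched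

variable {n : ℕ} {δ : ℝ} {α β : Measure (Fin n → ℝ)} {B : Set (Fin n → ℝ)}

lemma measurableSet (h : Matched δ α β B) : MeasurableSet B := by
  cases h with
  | leaf a b hab hδ heq => exact (isOpen_openBox a b).measurableSet
  | node _ _ _ hB => exact hB

lemma symm (h : Matched δ α β B) : Matched δ β α B := by
  induction h with
  | leaf a b hab hδ heq => exact leaf a b hab hδ heq.symm
  | node B B₁ B₂ hB h₁ h₂ hd hα hβ _ _ ih₁ ih₂ => exact node B B₁ B₂ hB h₁ h₂ hd hβ hα ih₁ ih₂

lemma congr (h : Matched δ α β B) {α' : Measure (Fin n → ℝ)}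
    (hα' : ∀ A ⊆ B, MeasurableSet A → α' A = α A) : Matched δ α' β B := by
  induction h with
  | leaf a b hab hδ heq =>
    exact leaf a b hab hδ
      ((hα' _ subset_rfl (isOpen_openBox a b).measurableSet).trans heq)
  | node B B₁ B₂ hB h₁ h₂ hd hα hβ m₁ m₂ ih₁ ih₂ =>
    refine node B B₁ B₂ hB h₁ h₂ hd ?_ hβ (ih₁ fun A hA => hα' A (hA.trans h₁))
      (ih₂ fun A hA => hα' A (hA.trans h₂))
    rw [hα' _ Set.sdiff_subset (hB.diff (m₁.measurableSet.union m₂.measurableSet)), hα]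

lemma glue {B₁ B₂ : Set (Fin n → ℝ)} (hB : MeasurableSet B) (h₁ : B₁ ⊆ B) (h₂ : B₂ ⊆ B)
    (hd : Disjoint B₁ B₂) (hα : α (B \ (B₁ ∪ B₂)) = 0) (hβ : β (B \ (B₁ ∪ B₂)) = 0)
    {f₁ f₂ : (Fin n → ℝ) ≃ₜ (Fin n → ℝ)}
    (hf₁ : ∀ x ∉ B₁, f₁ x = x) (hf₂ : ∀ x ∉ B₂, f₂ x = x)
    (m₁ : Matched δ (α.map f₁) β B₁) (m₂ : Matched δ (α.map f₂) β B₂) :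
    Matched δ (α.map (f₂.trans f₁)) β B := by
  have hm₁ := f₁.continuous.measurable
  have hm₂ := f₂.continuous.measurable
  have hm := (f₂.trans f₁).continuous.measurable
  have hx₁ : ∀ x ∈ B₁, f₂ x = x := fun x hx => hf₂ x (Set.disjoint_left.1 hd hx)
  have hx₂ : ∀ x ∈ B₂, f₁ x = x := fun x hx => hf₁ x (Set.disjoint_right.1 hd hx)
  refine node B B₁ B₂ hB h₁ h₂ hd ?_ hβ (m₁.congr ?_) (m₂.congr ?_)
  · have hD : MeasurableSet (B \ (B₁ ∪ B₂)) := hB.diff (m₁.measurableSet.union m₂.measurableSet)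
    rw [Measure.map_apply hm hD]
    refine measure_mono_null ?_ hα
    rintro x ⟨hxB, hx⟩
    simp only [Homeomorph.trans_apply, Set.mem_union, not_or] at hxB hx
    have hx1 : f₂ x ∉ B₁ := fun h => hx.1 ((Homeomorph.apply_mem_iff_of_eq_off hf₁ _).2 h)
    rw [hf₁ _ hx1] at hxB hx
    have hx2 : x ∉ B₂ := fun h => hx.2 ((Homeomorph.apply_mem_iff_of_eq_off hf₂ _).2 h)
    rw [hf₂ _ hx2] at hxB hx
    exact ⟨hxB, by simpa using hx⟩
  · intro A hA hAm
    rw [Measure.map_apply hm hAm, Measure.map_apply hm₁ hAm]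
    congr 1
    ext x
    simp only [Set.mem_preimage, Homeomorph.trans_apply]
    constructor
    · intro h
      have h1 := (Homeomorph.apply_mem_iff_of_eq_off hf₁ _).1 (hA h)
      have h2 : x ∉ B₂ := fun hx => Set.disjoint_left.1 hd h1
        ((Homeomorph.apply_mem_iff_of_eq_off hf₂ _).2 hx)
      rwa [hf₂ x h2] at h
    · intro h
      have h1 := (Homeomorph.apply_mem_iff_of_eq_off hf₁ _).1 (hA h)
      rwa [hx₁ x h1]
  · intro A hA hAm
    rw [Measure.map_apply hm hAm, Measure.map_apply hm₂ hAm]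
    congr 1
    ext x
    simp only [Set.mem_preimage, Homeomorph.trans_apply]
    constructor
    · intro h
      have h1 : f₂ x ∉ B₁ := fun hx => Set.disjoint_left.1 hd
        ((Homeomorph.apply_mem_iff_of_eq_off hf₁ _).2 hx) (hA h)
      rwa [hf₁ _ h1] at h
    · intro h
      rwa [hx₂ _ (hA h)]

lemma abs_setIntegral_sub_le [IsFiniteMeasure α] [IsFiniteMeasure β] (h : Matched δ α β B)
    (hδ0 : 0 ≤ δ)
    {φ : (Fin n → ℝ) → ℝ} (hα : Integrable φ α) (hβ : Integrable φ β) {ε : ℝ}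
    (hφ : ∀ x ∈ B, ∀ y ∈ B, dist x y ≤ δ → |φ x - φ y| ≤ ε) :
    |∫ x in B, φ x ∂α - ∫ x in B, φ x ∂β| ≤ 2 * ε * α.real B := by
  induction h with
  | leaf a b hab hδ heq =>
    obtain ⟨z, hz⟩ := openBox_nonempty hab
    have hdist : ∀ x ∈ openBox a b, ‖φ x - φ z‖ ≤ ε := by
      intro x hx
      refine hφ x hx z hz ((dist_pi_le_iff hδ0).2 fun i => ?_)
      have h1 := mem_openBox.1 hx i
      have h2 := mem_openBox.1 hz i
      rw [Real.dist_eq, abs_le]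
      constructor <;> linarith [h1.1, h1.2, h2.1, h2.2, hδ i]
    have key : ∀ γ : Measure (Fin n → ℝ), IsFiniteMeasure γ → Integrable φ γ →
        |∫ x in openBox a b, φ x ∂γ - φ z * γ.real (openBox a b)| ≤
          ε * γ.real (openBox a b) := by
      intro γ _ hγ
      have h1 : ∫ x in openBox a b, (φ x - φ z) ∂γ =
          ∫ x in openBox a b, φ x ∂γ - φ z * γ.real (openBox a b) := by
        rw [integral_sub hγ.restrict (integrable_const _), setIntegral_const, smul_eq_mul,
          mul_comm]
      rw [← h1, ← Real.norm_eq_abs]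
      exact norm_setIntegral_le_of_norm_le_const (measure_lt_top _ _) hdist
    have k1 := key α inferInstance hα
    have k2 := key β inferInstance hβ
    have : β.real (openBox a b) = α.real (openBox a b) := by simp [Measure.real, heq]
    rw [this] at k2
    rw [abs_le] at *
    constructor <;> linarith [k1.1, k1.2, k2.1, k2.2]
  | node B B₁ B₂ hB h₁ h₂ hd hα0 hβ0 m₁ m₂ ih₁ ih₂ =>
    have key : ∀ γ : Measure (Fin n → ℝ), γ (B \ (B₁ ∪ B₂)) = 0 →
        γ.restrict B = γ.restrict (B₁ ∪ B₂) := by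
      intro γ hγ
      apply Measure.restrict_congr_set
      refine (ae_eq_set).2 ⟨hγ, ?_⟩
      rw [Set.sdiff_eq_empty.2 (Set.union_subset h₁ h₂), measure_empty]
    have hr : α.real B = α.real B₁ + α.real B₂ := by
      rw [← measureReal_union hd m₂.measurableSet]
      have := congrArg (fun γ : Measure (Fin n → ℝ) => γ.real Set.univ) (key α hα0)
      simpa [Measure.real] using this
    rw [key α hα0, key β hβ0,
      setIntegral_union hd m₂.measurableSet hα.integrableOn hα.integrableOn,
      setIntegral_union hd m₂.measurableSet hβ.integrableOn hβ.integrableOn, hr]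
    have i₁ := ih₁ fun x hx y hy => hφ x (h₁ hx) y (h₁ hy)
    have i₂ := ih₂ fun x hx y hy => hφ x (h₂ hx) y (h₂ hy)
    rw [abs_le] at *
    constructor <;> linarith [i₁.1, i₁.2, i₂.1, i₂.2]

end Matched

lemma exists_matched_openBox {n : ℕ} {η : ℝ} (hη : 0 < η) (β : Measure (Fin n → ℝ))
    [IsFiniteMeasure β] (N : ℕ) :
    ∀ (a b : Fin n → ℝ), (∀ i, a i < b i) → (∑ i, (b i - a i) ≤ N * (η / 3)) →
    ∀ (α : Measure (Fin n → ℝ)) [IsFiniteMeasure α], (∀ p, α {p} = 0) →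
    (∀ O, IsOpen O → O.Nonempty → O ⊆ openBox a b → 0 < β O) →
    α (openBox a b) = β (openBox a b) →
    ∃ f : (Fin n → ℝ) ≃ₜ (Fin n → ℝ), (∀ x ∉ openBox a b, f x = x) ∧
      Matched η (α.map f) β (openBox a b) := by
  induction N with
  | zero =>
    intro a b hab hsum α _ hα hβ heq
    refine ⟨Homeomorph.refl _, fun _ _ => rfl, ?_⟩
    have : α.map (Homeomorph.refl (Fin n → ℝ)) = α := Measure.map_id
    rw [this]
    refine Matched.leaf a b hab (fun i => ?_) heq
    have h1 : b i - a i ≤ ∑ i, (b i - a i) :=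
      Finset.single_le_sum (f := fun i => b i - a i)
        (fun j _ => by have := hab j; linarith) (Finset.mem_univ i)
    simp at hsum
    have := hab i
    simp at h1
    linarith
  | succ N ih =>
    intro a b hab hsum α _ hα hβ heq
    by_cases hsmall : ∀ i, b i - a i ≤ η
    · refine ⟨Homeomorph.refl _, fun _ _ => rfl, ?_⟩
      have : α.map (Homeomorph.refl (Fin n → ℝ)) = α := Measure.map_id
      rw [this]
      exact Matched.leaf a b hab hsmall heq
    push Not at hsmall
    obtain ⟨i, hi⟩ := hsmall
    obtain ⟨c, hc, f₀, hf₀, hL, hR, hE, hEβ⟩ := exists_split_openBox i hab α β hα hβ heq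
    have hac : a i < c := by linarith [hc.1, hab i]
    have hcb : c < b i := by linarith [hc.2, hab i]
    have hLsub : openBox a (Function.update b i c) ⊆ openBox a b := by
      rw [openBox_update_right hcb]; exact Set.inter_subset_left
    have hRsub : openBox (Function.update a i c) b ⊆ openBox a b := by
      rw [openBox_update_left hac]; exact Set.inter_subset_left
    have hdisj : Disjoint (openBox a (Function.update b i c))
        (openBox (Function.update a i c) b) := by
      rw [openBox_update_left hac, openBox_update_right hcb, Set.disjoint_left]
      rintro x ⟨_, h⟩ ⟨_, h'⟩
      exact lt_asymm (show x i < c from h) h'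
    have hα₀ : ∀ p, α.map f₀ {p} = 0 := by
      intro p
      rw [Measure.map_apply f₀.continuous.measurable (measurableSet_singleton p)]
      have : f₀ ⁻¹' {p} = {f₀.symm p} := by
        ext x; simp [Homeomorph.eq_symm_apply]
      rw [this]; exact hα _
    have hsplit : ∑ j, (b j - a j) = (b i - a i) + ∑ j ∈ Finset.univ.erase i, (b j - a j) :=
      (Finset.add_sum_erase _ _ (Finset.mem_univ i)).symm
    obtain ⟨f₁, hf₁, m₁⟩ := ih a (Function.update b i c) (by
        intro j
        by_cases hj : j = i
        · subst hj; simpa using hac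
        · simpa [hj] using hab j) (by
        rw [← Finset.add_sum_erase _ _ (Finset.mem_univ i)]
        have : ∑ j ∈ Finset.univ.erase i, (Function.update b i c j - a j) =
            ∑ j ∈ Finset.univ.erase i, (b j - a j) := Finset.sum_congr rfl fun j hj => by
          rw [Function.update_of_ne (Finset.ne_of_mem_erase hj)]
        rw [this, Function.update_self]
        push_cast at hsum
        linarith [hc.2]) (α.map f₀) hα₀ (fun O h1 h2 h3 => hβ O h1 h2 (h3.trans hLsub)) hL
    obtain ⟨f₂, hf₂, m₂⟩ := ih (Function.update a i c) b (by
        intro j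
        by_cases hj : j = i
        · subst hj; simpa using hcb
        · simpa [hj] using hab j) (by
        rw [← Finset.add_sum_erase _ _ (Finset.mem_univ i)]
        have : ∑ j ∈ Finset.univ.erase i, (b j - Function.update a i c j) =
            ∑ j ∈ Finset.univ.erase i, (b j - a j) := Finset.sum_congr rfl fun j hj => by
          rw [Function.update_of_ne (Finset.ne_of_mem_erase hj)]
        rw [this, Function.update_self]
        push_cast at hsum
        linarith [hc.1]) (α.map f₀) hα₀ (fun O h1 h2 h3 => hβ O h1 h2 (h3.trans hRsub)) hR
    have m := Matched.glue (isOpen_openBox a b).measurableSet hLsub hRsub hdisj hE hEβ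
      hf₁ hf₂ m₁ m₂
    rw [Measure.map_map (f₂.trans f₁).continuous.measurable f₀.continuous.measurable] at m
    refine ⟨f₀.trans (f₂.trans f₁), fun x hx => ?_, m⟩
    rw [Homeomorph.trans_apply, Homeomorph.trans_apply, hf₀ x hx, hf₂ x fun h => hx (hRsub h),
      hf₁ x fun h => hx (hLsub h)]

/-- Matched measures become matched at any finer scale after a homeomorphism moving points less
than the old scale. -/
lemma Matched.exists_refine {n : ℕ} {δ η : ℝ} (hδ0 : 0 ≤ δ) (hη : 0 < η)
    {α β : Measure (Fin n → ℝ)} [IsFiniteMeasure α] [IsFiniteMeasure β] (hα : ∀ p, α {p} = 0)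
    {B : Set (Fin n → ℝ)} (h : Matched δ α β B)
    (hβ : ∀ O, IsOpen O → O.Nonempty → O ⊆ B → 0 < β O) :
    ∃ f : (Fin n → ℝ) ≃ₜ (Fin n → ℝ), (∀ x ∉ B, f x = x) ∧ (∀ x, dist (f x) x ≤ δ) ∧
      Matched η (α.map f) β B := by
  induction h with
  | leaf a b hab hδ heq =>
    obtain ⟨N, hN⟩ := exists_nat_ge ((∑ i, (b i - a i)) / (η / 3))
    rw [div_le_iff₀ (by positivity)] at hN
    obtain ⟨f, hf, m⟩ := exists_matched_openBox hη β N a b hab hN α hα hβ heq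
    refine ⟨f, hf, fun x => ?_, m⟩
    by_cases hx : x ∈ openBox a b
    · refine (dist_pi_le_iff hδ0).2 fun i => ?_
      have h1 := mem_openBox.1 hx i
      have h2 := mem_openBox.1 ((Homeomorph.apply_mem_iff_of_eq_off hf x).2 hx) i
      rw [Real.dist_eq, abs_le]
      constructor <;> linarith [h1.1, h1.2, h2.1, h2.2, hδ i]
    · rw [hf x hx, dist_self]; exact hδ0
  | node B B₁ B₂ hB h₁ h₂ hd hα0 hβ0 m₁ m₂ ih₁ ih₂ =>
    obtain ⟨f₁, hf₁, hd₁, n₁⟩ := ih₁ fun O h1 h2 h3 => hβ O h1 h2 (h3.trans h₁)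
    obtain ⟨f₂, hf₂, hd₂, n₂⟩ := ih₂ fun O h1 h2 h3 => hβ O h1 h2 (h3.trans h₂)
    refine ⟨f₂.trans f₁, fun x hx => ?_, fun x => ?_,
      Matched.glue hB h₁ h₂ hd hα0 hβ0 hf₁ hf₂ n₁ n₂⟩
    · rw [Homeomorph.trans_apply, hf₂ x fun h => hx (h₂ h), hf₁ x fun h => hx (h₁ h)]
    · rw [Homeomorph.trans_apply]
      by_cases hx : x ∈ B₂
      · have h2 := (Homeomorph.apply_mem_iff_of_eq_off hf₂ x).2 hx
        rw [hf₁ _ (Set.disjoint_right.1 hd h2)]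
        exact hd₂ x
      · rw [hf₂ x hx]
        exact hd₁ x

lemma exists_tendstoUniformly_of_dist_le {X : Type*} [MetricSpace X] [CompleteSpace X]
    (f : ℕ → X → X) (hf : ∀ k, Continuous (f k))
    (hd : ∀ k x, dist (f k x) (f (k + 1) x) ≤ (1 / 2 : ℝ) ^ k) :
    ∃ g : X → X, Continuous g ∧ TendstoUniformly f g Filter.atTop := by
  have hd' : ∀ x k, dist (f k x) (f (k + 1) x) ≤ 1 * (1 / 2 : ℝ) ^ k := fun x k => by
    rw [one_mul]; exact hd k x
  choose g hg using fun x => cauchySeq_tendsto_of_complete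
    (cauchySeq_of_le_geometric (1 / 2 : ℝ) 1 (by norm_num) (hd' x))
  have hu : TendstoUniformly f g Filter.atTop := by
    rw [Metric.tendstoUniformly_iff]
    intro ε hε
    obtain ⟨N, hN⟩ := exists_pow_lt_of_lt_one (half_pos hε) (by norm_num : (1 / 2 : ℝ) < 1)
    filter_upwards [Filter.eventually_ge_atTop N] with k hk x
    have h1 := dist_le_of_le_geometric_of_tendsto (1 / 2 : ℝ) 1 (by norm_num) (hd' x) (hg x) k
    have h2 : (1 / 2 : ℝ) ^ k ≤ (1 / 2) ^ N :=
      pow_le_pow_of_le_one (by norm_num) (by norm_num) hk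
    rw [dist_comm]
    norm_num at h1 h2 hN ⊢
    linarith
  exact ⟨g, hu.continuous (Filter.Frequently.of_forall hf), hu⟩

lemma exists_homeomorph_limit {X : Type*} [MetricSpace X] [CompleteSpace X] (F : ℕ → X ≃ₜ X)
    (h₁ : ∀ k x, dist (F k x) (F (k + 1) x) ≤ (1 / 2 : ℝ) ^ k)
    (h₂ : ∀ k x, dist ((F k).symm x) ((F (k + 1)).symm x) ≤ (1 / 2 : ℝ) ^ k) :
    ∃ G : X ≃ₜ X, ∀ x, Filter.Tendsto (fun k => F k x) Filter.atTop (nhds (G x)) := by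
  obtain ⟨g, hg, hgu⟩ := exists_tendstoUniformly_of_dist_le (fun k => F k)
    (fun k => (F k).continuous) h₁
  obtain ⟨g', hg', hgu'⟩ := exists_tendstoUniformly_of_dist_le (fun k => (F k).symm)
    (fun k => (F k).symm.continuous) h₂
  refine ⟨⟨⟨g, g', fun x => ?_, fun x => ?_⟩, hg, hg'⟩, fun x => hgu.tendsto_at x⟩
  · have := hgu'.tendsto_comp hg'.continuousAt (hgu.tendsto_at x)
    simp only [Homeomorph.symm_apply_apply] at this
    exact tendsto_nhds_unique this tendsto_const_nhds
  · have := hgu.tendsto_comp hg.continuousAt (hgu'.tendsto_at x)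
    simp only [Homeomorph.apply_symm_apply] at this
    exact tendsto_nhds_unique this tendsto_const_nhds

lemma openBox_subset_Icc {n : ℕ} (a b : Fin n → ℝ) : openBox a b ⊆ Set.Icc a b := fun _ hx =>
  ⟨fun i => (mem_openBox.1 hx i).1.le, fun i => (mem_openBox.1 hx i).2.le⟩

lemma exists_dist_le_of_eq_off_openBox {n : ℕ} {a b : Fin n → ℝ}
    {f : (Fin n → ℝ) ≃ₜ (Fin n → ℝ)} (hf : ∀ x ∉ openBox a b, f x = x) {ε : ℝ} (hε : 0 < ε) :
    ∃ δ, 0 < δ ∧ δ ≤ ε ∧ ∀ x y, dist x y ≤ δ → dist (f x) (f y) ≤ ε := by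
  have h1 : UniformContinuous (fun x => f x - x) := by
    refine HasCompactSupport.uniformContinuous_of_continuous ?_ (by fun_prop)
    refine HasCompactSupport.intro (isCompact_Icc (a := a) (b := b)) fun x hx => ?_
    rw [hf x fun h => hx (openBox_subset_Icc a b h), sub_self]
  have h2 : UniformContinuous f := by simpa using h1.add uniformContinuous_id
  obtain ⟨δ, hδ, h⟩ := Metric.uniformContinuous_iff.1 h2 ε hε
  refine ⟨min (δ / 2) ε, by positivity, min_le_right _ _, fun x y hxy => (h ?_).le⟩
  linarith [min_le_left (δ / 2) ε]

/-- A finite measure with no atoms, concentrated on `Q` and positive on open subsets of `Q`. -/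
structure GoodOn {X : Type*} [TopologicalSpace X] [MeasurableSpace X] (Q : Set X)
    (μ : Measure X) : Prop where
  finite : IsFiniteMeasure μ
  atom : ∀ p, μ {p} = 0
  compl : μ Qᶜ = 0
  pos : ∀ O, IsOpen O → O.Nonempty → O ⊆ Q → 0 < μ O

lemma GoodOn.map {X : Type*} [TopologicalSpace X] [MeasurableSpace X] [BorelSpace X] {Q : Set X}
    [MeasurableSingletonClass X]
    (hQ : MeasurableSet Q) {μ : Measure X} (hμ : GoodOn Q μ) {f : X ≃ₜ X}
    (hf : ∀ x ∉ Q, f x = x) : GoodOn Q (μ.map f) := by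
  have hm := f.continuous.measurable
  have hfin := hμ.finite
  refine ⟨inferInstance, fun p => ?_, ?_, fun O hO hne hOQ => ?_⟩
  · rw [Measure.map_apply hm (measurableSet_singleton p)]
    have : f ⁻¹' {p} = {f.symm p} := by ext x; simp [Homeomorph.eq_symm_apply]
    rw [this]; exact hμ.atom _
  · rw [Measure.map_apply hm hQ.compl]
    have : f ⁻¹' Qᶜ = Qᶜ := by
      ext x; simp [Homeomorph.apply_mem_iff_of_eq_off hf]
    rw [this]; exact hμ.compl
  · rw [Measure.map_apply hm hO.measurableSet]
    refine hμ.pos _ (hO.preimage f.continuous) ?_ fun x hx =>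
      (Homeomorph.apply_mem_iff_of_eq_off hf x).1 (hOQ hx)
    obtain ⟨y, hy⟩ := hne
    exact ⟨f.symm y, by simpa using hy⟩

section limit

variable {n : ℕ} {a b : Fin n → ℝ} {μ ν : Measure (Fin n → ℝ)}

/-- A stage of the back-and-forth construction. -/
structure MatchingStage (a b : Fin n → ℝ) (μ ν : Measure (Fin n → ℝ)) (k : ℕ)
    (F G : (Fin n → ℝ) ≃ₜ (Fin n → ℝ)) (δ : ℝ) : Prop where
  left_eq : ∀ x ∉ openBox a b, F x = x
  right_eq : ∀ x ∉ openBox a b, G x = x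
  scale_pos : 0 < δ
  scale_le : δ ≤ (1 / 2) ^ k
  dist_symm_le : ∀ x y, dist x y ≤ δ → dist (F.symm x) (F.symm y) ≤ (1 / 2) ^ k
  matched : Matched δ (μ.map F) (ν.map G) (openBox a b)

lemma trans_eq_off {X : Type*} [TopologicalSpace X] {Q : Set X} {F f : X ≃ₜ X}
    (hF : ∀ x ∉ Q, F x = x) (hf : ∀ x ∉ Q, f x = x) : ∀ x ∉ Q, (F.trans f) x = x := by
  intro x hx
  rw [Homeomorph.trans_apply, hF x hx, hf x hx]

/-- One half of a step: the measures are matched at scale `δ`, where `δ` is small in terms of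
`F`, and `F` is changed to match them at a smaller scale `δ'`. -/
lemma exists_matching_halfStep (hμ : GoodOn (openBox a b) μ) (hν : GoodOn (openBox a b) ν)
    {F G : (Fin n → ℝ) ≃ₜ (Fin n → ℝ)} (hF : ∀ x ∉ openBox a b, F x = x)
    (hG : ∀ x ∉ openBox a b, G x = x) {δ δ' ε : ℝ} (hδ : 0 < δ) (hδε : δ ≤ ε)
    (hd : ∀ x y, dist x y ≤ δ → dist (F.symm x) (F.symm y) ≤ ε) (hδ' : 0 < δ')
    (m : Matched δ (μ.map F) (ν.map G) (openBox a b)) :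
    ∃ F' : (Fin n → ℝ) ≃ₜ (Fin n → ℝ), (∀ x ∉ openBox a b, F' x = x) ∧
      (∀ x, dist (F x) (F' x) ≤ ε) ∧ (∀ x, dist (F.symm x) (F'.symm x) ≤ ε) ∧
      Matched δ' (μ.map F') (ν.map G) (openBox a b) := by
  have hQ := (isOpen_openBox a b).measurableSet
  have gμ := hμ.map hQ hF
  have gν := hν.map hQ hG
  have := gμ.finite
  have := gν.finite
  obtain ⟨f, hf, hfd, m'⟩ := m.exists_refine hδ.le hδ' gμ.atom gν.pos
  rw [Measure.map_map f.continuous.measurable F.continuous.measurable] at m'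
  refine ⟨F.trans f, trans_eq_off hF hf, fun x => ?_, fun x => ?_, m'⟩
  · rw [dist_comm]
    exact (hfd (F x)).trans hδε
  · apply hd
    simpa using hfd (f.symm x)

lemma MatchingStage.exists_next (hμ : GoodOn (openBox a b) μ) (hν : GoodOn (openBox a b) ν) {k : ℕ}
    {F G : (Fin n → ℝ) ≃ₜ (Fin n → ℝ)} {δ : ℝ} (h : MatchingStage a b μ ν k F G δ) :
    ∃ F' G' δ', MatchingStage a b μ ν (k + 1) F' G' δ' ∧
      (∀ x, dist (F x) (F' x) ≤ (1 / 2) ^ k) ∧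
      (∀ x, dist (F.symm x) (F'.symm x) ≤ (1 / 2) ^ k) ∧
      (∀ x, dist (G x) (G' x) ≤ (1 / 2) ^ k) ∧
      (∀ x, dist (G.symm x) (G'.symm x) ≤ (1 / 2) ^ k) := by
  obtain ⟨δ₁, hδ₁, hδ₁', hG⟩ := exists_dist_le_of_eq_off_openBox
    (Homeomorph.symm_apply_eq_off h.right_eq) (show (0 : ℝ) < (1 / 2) ^ k by positivity)
  obtain ⟨F', hF', d₁, d₂, m₁⟩ := exists_matching_halfStep hμ hν h.left_eq h.right_eq h.scale_pos
    h.scale_le h.dist_symm_le hδ₁ h.matched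
  obtain ⟨δ₂, hδ₂, hδ₂', hF''⟩ := exists_dist_le_of_eq_off_openBox
    (Homeomorph.symm_apply_eq_off hF') (show (0 : ℝ) < (1 / 2) ^ (k + 1) by positivity)
  obtain ⟨G', hG', d₃, d₄, m₂⟩ := exists_matching_halfStep hν hμ h.right_eq hF' hδ₁ hδ₁' hG hδ₂
    m₁.symm
  exact ⟨F', G', δ₂, ⟨hF', hG', hδ₂, hδ₂', hF'', m₂.symm⟩, d₁, d₂, d₃, d₄⟩

lemma exists_matchingStage_zero (hab : ∀ i, a i < b i) (hμ : GoodOn (openBox a b) μ)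
    (hν : GoodOn (openBox a b) ν) (heq : μ (openBox a b) = ν (openBox a b)) :
    ∃ F G δ, MatchingStage a b μ ν 0 F G δ := by
  have hnonneg : ∀ i, 0 ≤ b i - a i := fun i => by linarith [hab i]
  have m : Matched (∑ i, (b i - a i)) μ ν (openBox a b) := Matched.leaf a b hab (fun i =>
    Finset.single_le_sum (f := fun i => b i - a i) (fun j _ => hnonneg j) (Finset.mem_univ i)) heq
  have := hμ.finite
  have := hν.finite
  obtain ⟨g, hg, -, m'⟩ := m.symm.exists_refine (Finset.sum_nonneg fun i _ => hnonneg i)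
    one_pos hν.atom hμ.pos
  refine ⟨Homeomorph.refl _, g, 1, fun _ _ => rfl, hg, one_pos, by simp, by simp, ?_⟩
  have : μ.map (Homeomorph.refl (Fin n → ℝ)) = μ := Measure.map_id
  rw [this]
  exact m'.symm

/-- Two good measures of the same mass on an open box are homeomorphic by a homeomorphism
supported in the box. -/
theorem exists_homeomorph_map_eq_of_openBox (hab : ∀ i, a i < b i) (hμ : GoodOn (openBox a b) μ)
    (hν : GoodOn (openBox a b) ν) (heq : μ (openBox a b) = ν (openBox a b)) :
    ∃ h : (Fin n → ℝ) ≃ₜ (Fin n → ℝ), (∀ x ∉ openBox a b, h x = x) ∧ μ.map h = ν := by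
  have := hμ.finite
  have := hν.finite
  have hQ := (isOpen_openBox a b).measurableSet
  obtain ⟨F₀, G₀, δ₀, h₀⟩ := exists_matchingStage_zero hab hμ hν heq
  choose! nF nG nδ hstep using fun k F G δ (h : MatchingStage a b μ ν k F G δ) =>
    h.exists_next hμ hν
  let s : ℕ → ((Fin n → ℝ) ≃ₜ (Fin n → ℝ)) × ((Fin n → ℝ) ≃ₜ (Fin n → ℝ)) × ℝ := fun k =>
    Nat.rec (F₀, G₀, δ₀) (fun k p =>
      (nF k p.1 p.2.1 p.2.2, nG k p.1 p.2.1 p.2.2, nδ k p.1 p.2.1 p.2.2)) k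
  have hs : ∀ k, MatchingStage a b μ ν k (s k).1 (s k).2.1 (s k).2.2 := by
    intro k
    induction k with
    | zero => exact h₀
    | succ k ih => exact (hstep k _ _ _ ih).1
  obtain ⟨F, hF⟩ := exists_homeomorph_limit (fun k => (s k).1)
    (fun k => (hstep k _ _ _ (hs k)).2.1) (fun k => (hstep k _ _ _ (hs k)).2.2.1)
  obtain ⟨G, hG⟩ := exists_homeomorph_limit (fun k => (s k).2.1)
    (fun k => (hstep k _ _ _ (hs k)).2.2.2.1) (fun k => (hstep k _ _ _ (hs k)).2.2.2.2)
  have hFid : ∀ x ∉ openBox a b, F x = x := fun x hx => tendsto_nhds_unique (hF x)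
    (tendsto_const_nhds.congr fun k => ((hs k).left_eq x hx).symm)
  have hGid : ∀ x ∉ openBox a b, G x = x := fun x hx => tendsto_nhds_unique (hG x)
    (tendsto_const_nhds.congr fun k => ((hs k).right_eq x hx).symm)
  have hmain : μ.map F = ν.map G := by
    apply ext_of_forall_integral_eq_of_IsFiniteMeasure
    intro φ
    have hmap : ∀ (γ : Measure (Fin n → ℝ)) (f : (Fin n → ℝ) ≃ₜ (Fin n → ℝ)),
        ∫ x, φ x ∂(γ.map f) = ∫ x, φ (f x) ∂γ := fun γ f =>
      integral_map f.continuous.aemeasurable φ.continuous.aestronglyMeasurable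
    have hlim : ∀ (γ : Measure (Fin n → ℝ)) [IsFiniteMeasure γ]
        (f : ℕ → (Fin n → ℝ) ≃ₜ (Fin n → ℝ)) (g : (Fin n → ℝ) ≃ₜ (Fin n → ℝ)),
        (∀ x, Filter.Tendsto (fun k => f k x) Filter.atTop (nhds (g x))) →
        Filter.Tendsto (fun k => ∫ x, φ x ∂(γ.map (f k))) Filter.atTop
          (nhds (∫ x, φ x ∂(γ.map g))) := by
      intro γ _ f g hfg
      simp only [hmap]
      refine tendsto_integral_of_dominated_convergence (fun _ => ‖φ‖)
        (fun k => (φ.continuous.comp (f k).continuous).aestronglyMeasurable)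
        (integrable_const _) (fun k => Filter.Eventually.of_forall fun x => φ.norm_coe_le_norm _)
        (Filter.Eventually.of_forall fun x => ?_)
      exact (φ.continuous.tendsto _).comp (hfg x)
    have hdiff := ((hlim μ _ F hF).sub (hlim ν _ G hG)).abs
    rw [← sub_eq_zero, ← abs_nonpos_iff]
    refine le_of_forall_pos_le_add fun ε hε => ?_
    rw [zero_add]
    set c : ℝ := 2 * μ.real (openBox a b) + 1 with hc
    have hc0 : 0 < c := by positivity
    have huc := (isCompact_Icc (a := a) (b := b)).uniformContinuousOn_of_continuous
      φ.continuous.continuousOn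
    obtain ⟨η, hη, hφ⟩ := Metric.uniformContinuousOn_iff.1 huc (ε / c) (by positivity)
    obtain ⟨N, hN⟩ := exists_pow_lt_of_lt_one hη (by norm_num : (1 / 2 : ℝ) < 1)
    refine le_of_tendsto hdiff ?_
    filter_upwards [Filter.eventually_ge_atTop N] with k hk
    have hsk := hs k
    have hδη : (s k).2.2 < η := hsk.scale_le.trans_lt
      ((pow_le_pow_of_le_one (by norm_num) (by norm_num) hk).trans_lt hN)
    have gμ := hμ.map hQ hsk.left_eq
    have gν := hν.map hQ hsk.right_eq
    have hest := hsk.matched.abs_setIntegral_sub_le hsk.scale_pos.le (φ := φ) (φ.integrable _)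
      (φ.integrable _) (ε := ε / c) (fun x hx y hy hxy => by
        have := hφ x (openBox_subset_Icc a b hx) y (openBox_subset_Icc a b hy)
          (hxy.trans_lt hδη)
        rw [Real.dist_eq] at this
        exact this.le)
    rw [Measure.restrict_eq_self_of_ae_mem (measure_eq_zero_iff_ae_notMem.1 gμ.compl |>.mono
        fun x hx => not_not.1 hx),
      Measure.restrict_eq_self_of_ae_mem (measure_eq_zero_iff_ae_notMem.1 gν.compl |>.mono
        fun x hx => not_not.1 hx)] at hest
    refine hest.trans ?_
    have hmass : (μ.map (s k).1).real (openBox a b) = μ.real (openBox a b) := by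
      rw [Measure.real, Measure.map_apply (s k).1.continuous.measurable hQ, Measure.real]
      congr 2
      ext x
      exact Homeomorph.apply_mem_iff_of_eq_off hsk.left_eq x
    rw [hmass]
    have : 2 * (ε / c) * μ.real (openBox a b) = ε / c * (c - 1) := by rw [hc]; ring
    rw [this]
    have : ε / c * (c - 1) = ε - ε / c := by field_simp
    rw [this]
    have : 0 < ε / c := by positivity
    linarith
  refine ⟨F.trans G.symm, trans_eq_off hFid (Homeomorph.symm_apply_eq_off hGid), ?_⟩
  have h1 : μ.map (F.trans G.symm) = (μ.map F).map G.symm :=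
    (Measure.map_map G.symm.continuous.measurable F.continuous.measurable).symm
  rw [h1, hmain, Measure.map_map G.symm.continuous.measurable G.continuous.measurable]
  simp

end limit

/-! ### The Alexander isotopy -/

section Alexander

variable {E : Type*} [NormedAddCommGroup E] [NormedSpace ℝ E]

/-- The Alexander isotopy from the identity (at `t = 0`) to `f` (at `t = 1`). -/
noncomputable def alexander (f : E → E) (t : ℝ) (y : E) : E :=
  y + t • (f (t⁻¹ • y) - t⁻¹ • y)

lemma alexander_zero (f : E → E) (y : E) : alexander f 0 y = y := by
  simp [alexander]

lemma alexander_one (f : E → E) (y : E) : alexander f 1 y = f y := by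
  simp [alexander]

lemma alexander_of_ne_zero (f : E → E) {t : ℝ} (ht : t ≠ 0) (y : E) :
    alexander f t y = t • f (t⁻¹ • y) := by
  simp [alexander, smul_sub, smul_smul, ht]

lemma alexander_leftInverse {f g : E → E} (h : Function.LeftInverse g f) (t : ℝ) :
    Function.LeftInverse (alexander g t) (alexander f t) := by
  intro y
  rcases eq_or_ne t 0 with rfl | ht
  · simp [alexander_zero]
  · simp [alexander_of_ne_zero _ ht, smul_smul, ht, h _]

lemma alexander_eq_off {f : E → E} (hf : ∀ y ∉ Metric.ball (0 : E) 1, f y = y) {t : ℝ}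
    (h0 : 0 ≤ t) (h1 : t ≤ 1) {y : E} (hy : y ∉ Metric.ball (0 : E) 1) :
    alexander f t y = y := by
  rcases h0.eq_or_lt with rfl | h0
  · exact alexander_zero f y
  · have : t⁻¹ • y ∉ Metric.ball (0 : E) 1 := by
      simp only [Metric.mem_ball, dist_zero_right, not_lt] at hy ⊢
      rw [norm_smul, Real.norm_of_nonneg (inv_nonneg.2 h0.le)]
      exact one_le_mul_of_one_le_of_one_le ((one_le_inv₀ h0).2 h1) hy
    rw [alexander, hf _ this, sub_self, smul_zero, add_zero]

lemma continuous_alexander {f : E → E} (hf : Continuous f) {C : ℝ}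
    (hC : ∀ y, ‖f y - y‖ ≤ C) : Continuous fun p : ℝ × E => alexander f p.1 p.2 := by
  rw [continuous_iff_continuousAt]
  rintro ⟨t, y⟩
  refine continuousAt_snd.add ?_
  rcases eq_or_ne t 0 with rfl | ht
  · rw [ContinuousAt, zero_smul]
    refine squeeze_zero_norm (a := fun p : ℝ × E => |p.1| * C) (fun p => ?_) ?_
    · rw [norm_smul, Real.norm_eq_abs]
      exact mul_le_mul_of_nonneg_left (hC _) (abs_nonneg _)
    · have : Continuous fun p : ℝ × E => |p.1| * C := by fun_prop
      simpa using this.tendsto ((0 : ℝ), y)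
  · have hinv : ContinuousAt (fun p : ℝ × E => p.1⁻¹ • p.2) (t, y) :=
      (continuousAt_fst.inv₀ ht).smul continuousAt_snd
    exact continuousAt_fst.smul ((hf.continuousAt.comp hinv).sub hinv)

end Alexander

/-! ### Extending homeomorphisms from a chart -/

section Extend

variable {M E : Type*} [TopologicalSpace M] [NormedAddCommGroup E]

open Classical in
/-- The self-map of `M` that is `f` read in the chart `ψ`, and the identity off the chart. -/
noncomputable def chartExtend (ψ : OpenPartialHomeomorph M E) (f : E → E) (x : M) : M :=
  if x ∈ ψ.source then ψ.symm (f (ψ x)) else x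

variable {ψ : OpenPartialHomeomorph M E}

lemma chartExtend_of_mem (f : E → E) {x : M} (hx : x ∈ ψ.source) :
    chartExtend ψ f x = ψ.symm (f (ψ x)) := if_pos hx

lemma chartExtend_of_fixed {f : E → E} {x : M} (hx : x ∈ ψ.source → f (ψ x) = ψ x) :
    chartExtend ψ f x = x := by
  by_cases h : x ∈ ψ.source
  · rw [chartExtend_of_mem f h, hx h, ψ.left_inv h]
  · exact if_neg h

lemma chartExtend_leftInverse {f g : E → E} (hf : Set.MapsTo f ψ.target ψ.target)
    (h : Function.LeftInverse g f) :
    Function.LeftInverse (chartExtend ψ g) (chartExtend ψ f) := by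
  intro x
  by_cases hx : x ∈ ψ.source
  · have hy := hf (ψ.map_source hx)
    rw [chartExtend_of_mem f hx, chartExtend_of_mem g (ψ.map_target hy), ψ.right_inv hy, h,
      ψ.left_inv hx]
  · have : chartExtend ψ f x = x := if_neg hx
    rw [this]
    exact if_neg hx

lemma continuous_chartExtend [T2Space M] [ProperSpace E] {T : Type*} [TopologicalSpace T]
    (hψ : Metric.closedBall (0 : E) 1 ⊆ ψ.target) {F : T → E → E}
    (hF : Continuous fun p : T × E => F p.1 p.2)
    (hm : ∀ t, Set.MapsTo (F t) ψ.target ψ.target)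
    (hoff : ∀ t, ∀ y ∉ Metric.ball (0 : E) 1, F t y = y) :
    Continuous fun p : T × M => chartExtend ψ (F p.1) p.2 := by
  rw [continuous_iff_continuousAt]
  rintro ⟨t, x⟩
  by_cases hx : x ∈ ψ.source
  · have h1 : ContinuousAt (fun p : T × M => F p.1 (ψ p.2)) (t, x) :=
      hF.continuousAt.comp (f := fun p : T × M => (p.1, ψ p.2)) (x := (t, x))
        (continuousAt_fst.prodMk ((ψ.continuousAt hx).comp continuousAt_snd))
    have h2 : ContinuousAt (fun p : T × M => ψ.symm (F p.1 (ψ p.2))) (t, x) :=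
      ContinuousAt.comp (f := fun p : T × M => F p.1 (ψ p.2)) (x := (t, x))
        (ψ.continuousAt_symm (hm t (ψ.map_source hx))) h1
    refine h2.congr ?_
    filter_upwards [continuousAt_snd.preimage_mem_nhds (ψ.open_source.mem_nhds hx)] with p hp
    exact (chartExtend_of_mem _ hp).symm
  · have hK : IsClosed (ψ.symm '' Metric.closedBall (0 : E) 1) :=
      ((isCompact_closedBall 0 1).image_of_continuousOn (ψ.continuousOn_symm.mono hψ)).isClosed
    have hxK : x ∈ (ψ.symm '' Metric.closedBall (0 : E) 1)ᶜ := by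
      rintro ⟨y, hy, rfl⟩
      exact hx (ψ.map_target (hψ hy))
    refine continuousAt_snd.congr ?_
    filter_upwards [continuousAt_snd.preimage_mem_nhds (hK.isOpen_compl.mem_nhds hxK)] with p hp
    refine (chartExtend_of_fixed fun hs => hoff _ _ fun hb => hp ?_).symm
    exact ⟨ψ p.2, Metric.ball_subset_closedBall hb, ψ.left_inv hs⟩

/-- The extension by the identity of a homeomorphism supported in a chart ball is isotopic to
the identity. -/
lemma exists_joinedIn_chartExtend [NormedSpace ℝ E] [T2Space M] [ProperSpace E]
    (hψ : Metric.closedBall (0 : E) 1 ⊆ ψ.target) (f : E ≃ₜ E)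
    (hf : ∀ y ∉ Metric.ball (0 : E) 1, f y = y) :
    ∃ h : C(M, M), JoinedIn (HomeoSet M) (ContinuousMap.id M) h ∧ ⇑h = chartExtend ψ f := by
  have key : ∀ f : E ≃ₜ E, (∀ y ∉ Metric.ball (0 : E) 1, f y = y) →
      Continuous (fun p : unitInterval × M => chartExtend ψ (alexander f p.1) p.2) ∧
      ∀ t : unitInterval, Set.MapsTo (alexander f t) ψ.target ψ.target := by
    intro f hf
    have hoff : ∀ t : unitInterval, ∀ y ∉ Metric.ball (0 : E) 1, alexander f t y = y :=
      fun t y hy => alexander_eq_off hf t.2.1 t.2.2 hy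
    have hb : ∀ y, ‖f y - y‖ ≤ 2 := by
      intro y
      by_cases hy : y ∈ Metric.ball (0 : E) 1
      · have h1 := (Homeomorph.apply_mem_iff_of_eq_off hf y).2 hy
        rw [Metric.mem_ball, dist_zero_right] at h1 hy
        linarith [norm_sub_le (f y) y]
      · rw [hf y hy]; simp
    have hcont := continuous_alexander f.continuous hb
    have hm : ∀ t : unitInterval, Set.MapsTo (alexander f t) ψ.target ψ.target := by
      intro t y hy
      by_cases h : alexander f t y ∈ Metric.ball (0 : E) 1
      · exact hψ (Metric.ball_subset_closedBall h)
      · have h2 := alexander_leftInverse f.left_inv (t : ℝ) y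
        have h3 := alexander_eq_off (f := f.symm) (Homeomorph.symm_apply_eq_off hf)
          t.2.1 t.2.2 h
        have h4 : alexander f t y = y := by rw [← h3]; exact h2
        rwa [h4]
    refine ⟨continuous_chartExtend hψ (F := fun t : unitInterval => alexander f t) ?_ hm hoff, hm⟩
    exact hcont.comp (f := fun p : unitInterval × E => ((p.1 : ℝ), p.2)) (by fun_prop)
  obtain ⟨hc, hm⟩ := key f hf
  obtain ⟨hc', hm'⟩ := key f.symm (Homeomorph.symm_apply_eq_off hf)
  let Γ : C(unitInterval, C(M, M)) := ContinuousMap.curry ⟨_, hc⟩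
  refine ⟨Γ 1, ⟨⟨Γ, ?_, rfl⟩, fun t => ?_⟩, ?_⟩
  · ext x
    exact chartExtend_of_fixed fun _ => alexander_zero _ _
  · exact Homeomorph.isHomeomorph
      { toFun := chartExtend ψ (alexander f t)
        invFun := chartExtend ψ (alexander f.symm t)
        left_inv := chartExtend_leftInverse (hm t) (alexander_leftInverse f.left_inv _)
        right_inv := chartExtend_leftInverse (hm' t) (alexander_leftInverse f.right_inv _)
        continuous_toFun := hc.comp (f := fun x : M => (t, x)) (by fun_prop)
        continuous_invFun := hc'.comp (f := fun x : M => (t, x)) (by fun_prop) }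
  · have : alexander f 1 = f := funext (alexander_one f)
    change chartExtend ψ (alexander f ((1 : unitInterval) : ℝ)) = _
    rw [Set.Icc.coe_one, this]

lemma JoinedIn.homeoSet_comp [LocallyCompactSpace M] {f g : C(M, M)}
    (hf : JoinedIn (HomeoSet M) (ContinuousMap.id M) f)
    (hg : JoinedIn (HomeoSet M) (ContinuousMap.id M) g) :
    JoinedIn (HomeoSet M) (ContinuousMap.id M) (g.comp f) := by
  obtain ⟨γ, hγ⟩ := hf
  obtain ⟨δ, hδ⟩ := hg
  refine ⟨⟨⟨fun t => (δ t).comp (γ t), δ.continuous.compCM γ.continuous⟩, ?_, ?_⟩, fun t => ?_⟩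
  · simp
  · simp
  · exact (hδ t).comp (hγ t)

end Extend

/-- Every point of a topological manifold has a chart that sends it into the unit ball and
whose target contains the closed unit ball. -/
lemma exists_unit_chart {n : ℕ} {M : Type*} [TopologicalSpace M] {x : M} {U : Set M}
    (hU : IsOpen U) (hx : x ∈ U) {V : Set (Fin n → ℝ)} (hV : IsOpen V) (e : U ≃ₜ V) :
    ∃ ψ : OpenPartialHomeomorph M (Fin n → ℝ), x ∈ ψ.source ∧ ψ x ∈ Metric.ball (0 : Fin n → ℝ) 1 ∧
      Metric.closedBall (0 : Fin n → ℝ) 1 ⊆ ψ.target := by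
  have : Nonempty U := ⟨⟨x, hx⟩⟩
  have : Nonempty V := ⟨e ⟨x, hx⟩⟩
  let i : OpenPartialHomeomorph U M := hU.isOpenEmbedding_subtypeVal.toOpenPartialHomeomorph _
  let j : OpenPartialHomeomorph V (Fin n → ℝ) :=
    hV.isOpenEmbedding_subtypeVal.toOpenPartialHomeomorph _
  set c : Fin n → ℝ := (e ⟨x, hx⟩ : Fin n → ℝ) with hc
  obtain ⟨r, hr, hrV⟩ := Metric.nhds_basis_closedBall.mem_iff.1 (hV.mem_nhds (e ⟨x, hx⟩).2)
  let a : (Fin n → ℝ) ≃ₜ (Fin n → ℝ) :=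
    (Homeomorph.addRight (-c)).trans (Homeomorph.smulOfNeZero r⁻¹ (inv_ne_zero hr.ne'))
  let ψ := ((i.symm.trans e.toOpenPartialHomeomorph).trans j).trans a.toOpenPartialHomeomorph
  have hi : i.symm x = ⟨x, hx⟩ := by
    have := i.left_inv (x := ⟨x, hx⟩) (by simp [i])
    simpa [i] using this
  refine ⟨ψ, ?_, ?_, ?_⟩
  · simp [ψ, i, j, hx]
  · have : ψ x = a (e (i.symm x)) := rfl
    rw [this, hi]
    simp [a, ← hc]
  · intro y hy
    have h2 : a.symm y ∈ V := by
      apply hrV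
      have : a.symm y = r • y + c := by
        rw [Homeomorph.symm_apply_eq]
        simp [a, smul_smul, hr.ne']
      rw [this, Metric.mem_closedBall, dist_eq_norm, add_sub_cancel_right, norm_smul,
        Real.norm_of_nonneg hr.le]
      rw [mem_closedBall_zero_iff] at hy
      nlinarith
    simpa [ψ, i, j] using h2

/-! ### Flexible open sets -/

/-- The measure `κ` off `V`, replaced on `V` by multiples of `μ` on `V \ U` and on `U ∩ V`. -/
noncomputable def mixMeasure {M : Type*} [MeasurableSpace M] (U V : Set M) (μ κ : Measure M)
    (t c : ENNReal) : Measure M :=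
  κ.restrict Vᶜ + t • μ.restrict (V \ U) + c • μ.restrict (U ∩ V)

lemma mixMeasure_apply {M : Type*} [MeasurableSpace M] {U V : Set M} (μ κ : Measure M)
    (t c : ENNReal) {A : Set M} (hA : MeasurableSet A) :
    mixMeasure U V μ κ t c A = κ (A ∩ Vᶜ) + t * μ (A ∩ (V \ U)) + c * μ (A ∩ (U ∩ V)) := by
  simp [mixMeasure, Measure.restrict_apply hA]

section Flexible

variable {M : Type*} [TopologicalSpace M] [MeasurableSpace M] [BorelSpace M]

/-- A set `U` is flexible if any two good measures that agree off `U` and have the same mass on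
`U` are related by a homeomorphism isotopic to the identity. -/
def Flexible (U : Set M) : Prop :=
  ∀ μ ν : Measure M, GoodOn Set.univ μ → GoodOn Set.univ ν →
    μ.restrict Uᶜ = ν.restrict Uᶜ → μ U = ν U →
    ∃ h : C(M, M), JoinedIn (HomeoSet M) (ContinuousMap.id M) h ∧ μ.map h = ν

lemma ball_eq_openBox (n : ℕ) :
    Metric.ball (0 : Fin n → ℝ) 1 = openBox (fun _ => -1) (fun _ => 1) := by
  ext x
  rw [ball_pi _ one_pos, mem_openBox]
  simp [Real.ball_eq_Ioo]

lemma GoodOn.map_chart {n : ℕ} {ψ : OpenPartialHomeomorph M (Fin n → ℝ)}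
    (hψ : Metric.closedBall (0 : Fin n → ℝ) 1 ⊆ ψ.target) {μ : Measure M}
    (hμ : GoodOn Set.univ μ) :
    GoodOn (Metric.ball (0 : Fin n → ℝ) 1)
      ((μ.restrict (ψ.source ∩ ψ ⁻¹' Metric.ball 0 1)).map ψ) := by
  have hU : IsOpen (ψ.source ∩ ψ ⁻¹' Metric.ball (0 : Fin n → ℝ) 1) :=
    ψ.isOpen_inter_preimage Metric.isOpen_ball
  have hae : AEMeasurable ψ (μ.restrict (ψ.source ∩ ψ ⁻¹' Metric.ball 0 1)) :=
    (ψ.continuousOn.mono Set.inter_subset_left).aemeasurable hU.measurableSet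
  have hfin := hμ.finite
  have happly : ∀ A : Set (Fin n → ℝ), MeasurableSet A →
      (μ.restrict (ψ.source ∩ ψ ⁻¹' Metric.ball 0 1)).map ψ A =
        μ (ψ ⁻¹' A ∩ (ψ.source ∩ ψ ⁻¹' Metric.ball 0 1)) := fun A hA => by
    rw [Measure.map_apply_of_aemeasurable hae hA, Measure.restrict_apply' hU.measurableSet]
  refine ⟨inferInstance, fun p => ?_, ?_, fun O hO hne hsub => ?_⟩
  · rw [happly _ (measurableSet_singleton p)]
    refine measure_mono_null ?_ (hμ.atom (ψ.symm p))
    rintro x ⟨hxp, hx, -⟩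
    rw [Set.mem_preimage, Set.mem_singleton_iff] at hxp
    rw [Set.mem_singleton_iff, ← hxp, ψ.left_inv hx]
  · rw [happly _ Metric.isOpen_ball.measurableSet.compl]
    convert measure_empty (μ := μ)
    ext x
    simp +contextual
  · rw [happly _ hO.measurableSet]
    refine (hμ.pos _ (ψ.isOpen_inter_preimage hO) ?_ (Set.subset_univ _)).trans_le
      (measure_mono fun x hx => ⟨hx.2, hx.1, hsub hx.2⟩)
    obtain ⟨o, ho⟩ := hne
    have hot : o ∈ ψ.target := hψ (Metric.ball_subset_closedBall (hsub ho))
    exact ⟨ψ.symm o, ψ.map_target hot, by rwa [Set.mem_preimage, ψ.right_inv hot]⟩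

lemma flexible_chart_ball [T2Space M] {n : ℕ} {ψ : OpenPartialHomeomorph M (Fin n → ℝ)}
    (hψ : Metric.closedBall (0 : Fin n → ℝ) 1 ⊆ ψ.target) :
    Flexible (ψ.source ∩ ψ ⁻¹' Metric.ball 0 1) := by
  intro μ ν hμ hν hoff hmass
  have hα := hμ.map_chart hψ
  have hβ := hν.map_chart hψ
  set B : Set (Fin n → ℝ) := Metric.ball 0 1 with hB
  have hBm : MeasurableSet B := Metric.isOpen_ball.measurableSet
  have hU : IsOpen (ψ.source ∩ ψ ⁻¹' B) := ψ.isOpen_inter_preimage Metric.isOpen_ball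
  set U := ψ.source ∩ ψ ⁻¹' B with hUdef
  have hae : ∀ κ : Measure M, AEMeasurable ψ (κ.restrict U) := fun κ =>
    (ψ.continuousOn.mono Set.inter_subset_left).aemeasurable hU.measurableSet
  have hBmass : ∀ κ : Measure M, (κ.restrict U).map ψ B = κ U := fun κ => by
    rw [Measure.map_apply_of_aemeasurable (hae κ) hBm, Measure.restrict_apply' hU.measurableSet,
      Set.inter_eq_self_of_subset_right Set.inter_subset_right]
  have heq : (μ.restrict U).map ψ B = (ν.restrict U).map ψ B := by
    rw [hBmass, hBmass, hmass]
  obtain ⟨f, hfoff, hfmap⟩ := exists_homeomorph_map_eq_of_openBox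
    (a := fun _ : Fin n => (-1 : ℝ)) (b := fun _ => 1) (fun _ => by norm_num)
    (by rw [← ball_eq_openBox]; exact hα) (by rw [← ball_eq_openBox]; exact hβ)
    (by rw [← ball_eq_openBox]; exact heq)
  rw [← ball_eq_openBox] at hfoff
  obtain ⟨h, hjoin, hcoe⟩ := exists_joinedIn_chartExtend hψ f hfoff
  refine ⟨h, hjoin, ?_⟩
  have hhm : Measurable h := h.continuous.measurable
  have hsymm : AEMeasurable ψ.symm ((ν.restrict U).map ψ) := by
    have h1 : AEMeasurable ψ.symm (((ν.restrict U).map ψ).restrict B) :=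
      (ψ.continuousOn_symm.mono (Metric.ball_subset_closedBall.trans hψ)).aemeasurable hBm
    rwa [Measure.restrict_eq_self_of_ae_mem (s := B) (mem_ae_iff.2 hβ.compl)] at h1
  have hin : (μ.restrict U).map h = ν.restrict U := by
    have h1 : h =ᵐ[μ.restrict U] ψ.symm ∘ (f ∘ ψ) := by
      filter_upwards [ae_restrict_mem hU.measurableSet] with x hx
      rw [hcoe, chartExtend_of_mem _ hx.1]; rfl
    have h2 : ψ.symm ∘ ψ =ᵐ[ν.restrict U] id := by
      filter_upwards [ae_restrict_mem hU.measurableSet] with x hx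
      exact ψ.left_inv hx.1
    have hfψ : (μ.restrict U).map (f ∘ ψ) = (ν.restrict U).map ψ := by
      rw [← AEMeasurable.map_map_of_aemeasurable f.continuous.aemeasurable (hae μ), hfmap]
    rw [Measure.map_congr h1, ← AEMeasurable.map_map_of_aemeasurable (by rwa [hfψ])
      (f.continuous.measurable.comp_aemeasurable (hae μ)), hfψ,
      AEMeasurable.map_map_of_aemeasurable hsymm (hae ν), Measure.map_congr h2, Measure.map_id]
  have hout : (μ.restrict Uᶜ).map h = ν.restrict Uᶜ := by
    have h1 : h =ᵐ[μ.restrict Uᶜ] id := by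
      filter_upwards [ae_restrict_mem hU.measurableSet.compl] with x hx
      rw [hcoe]
      exact chartExtend_of_fixed fun hs => hfoff _ fun hb => hx ⟨hs, hb⟩
    rw [Measure.map_congr h1, Measure.map_id, hoff]
  rw [← Measure.restrict_add_restrict_compl (μ := μ) hU.measurableSet, Measure.map_add _ _ hhm,
    hin, hout, Measure.restrict_add_restrict_compl hU.measurableSet]

lemma goodOn_mixMeasure {U V : Set M} (hU : IsOpen U) (hV : IsOpen V) {μ κ : Measure M}
    (hμ : GoodOn Set.univ μ) (hκ : GoodOn Set.univ κ) [T1Space M] {t c : ENNReal}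
    (ht : t ≠ 0) (ht' : t ≠ ⊤) (hc : c ≠ 0) (hc' : c ≠ ⊤) :
    GoodOn Set.univ (mixMeasure U V μ κ t c) := by
  have hfinμ := hμ.finite
  have hfinκ := hκ.finite
  refine ⟨⟨?_⟩, fun p => ?_, by simp, fun O hO hne _ => ?_⟩
  · rw [mixMeasure_apply _ _ _ _ MeasurableSet.univ]
    exact ENNReal.add_lt_top.2 ⟨ENNReal.add_lt_top.2 ⟨measure_lt_top _ _,
      ENNReal.mul_lt_top ht'.lt_top (measure_lt_top _ _)⟩,
      ENNReal.mul_lt_top hc'.lt_top (measure_lt_top _ _)⟩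
  · rw [mixMeasure_apply _ _ _ _ (measurableSet_singleton p),
      measure_mono_null Set.inter_subset_left (hκ.atom p),
      measure_mono_null Set.inter_subset_left (hμ.atom p),
      measure_mono_null Set.inter_subset_left (hμ.atom p)]
    simp
  · rw [mixMeasure_apply _ _ _ _ hO.measurableSet]
    rcases (O ∩ (U ∩ V)).eq_empty_or_nonempty with h1 | h1
    · rcases (O ∩ V).eq_empty_or_nonempty with h2 | h2
      · have h3 : O ∩ Vᶜ = O :=
          Set.inter_eq_left.2 fun x hx hxV => (h2 ▸ ⟨hx, hxV⟩ : x ∈ (∅ : Set M))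
        rw [h3]
        exact (hκ.pos O hO hne (Set.subset_univ _)).trans_le (le_add_right le_self_add)
      · have h3 : O ∩ (V \ U) = O ∩ V := by
          refine (Set.inter_subset_inter_right _ Set.sdiff_subset).antisymm fun x hx =>
            ⟨hx.1, hx.2, fun hxU => (h1 ▸ ⟨hx.1, hxU, hx.2⟩ : x ∈ (∅ : Set M))⟩
        rw [h3]
        exact (ENNReal.mul_pos ht (hμ.pos _ (hO.inter hV) h2 (Set.subset_univ _)).ne').trans_le
          (le_add_right le_add_self)
    · exact (ENNReal.mul_pos hc (hμ.pos _ (hO.inter (hU.inter hV)) h1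
        (Set.subset_univ _)).ne').trans_le le_add_self

lemma Flexible.union [T1Space M] [LocallyCompactSpace M] {U V : Set M} (hU : IsOpen U)
    (hV : IsOpen V) (hne : (U ∩ V).Nonempty) (hfU : Flexible U) (hfV : Flexible V) :
    Flexible (U ∪ V) := by
  intro μ ν hμ hν hoff hmass
  have hfinμ := hμ.finite
  have hfinν := hν.finite
  have hUm := hU.measurableSet
  have hVm := hV.measurableSet
  have hm0 : μ (U ∩ V) ≠ 0 := (hμ.pos _ (hU.inter hV) hne (Set.subset_univ _)).ne'
  have hm1 : μ (U ∩ V) ≠ ⊤ := measure_ne_top _ _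
  have hVpos : ∀ κ : Measure M, GoodOn Set.univ κ → 0 < κ V := fun κ hκ =>
    hκ.pos V hV (hne.mono Set.inter_subset_right) (Set.subset_univ _)
  obtain ⟨t, ht, htlt⟩ := ENNReal.exists_nnreal_pos_mul_lt (measure_ne_top μ (V \ U))
    (lt_min (hVpos μ hμ) (hVpos ν hν)).ne'
  have ht0 : (t : ENNReal) ≠ 0 := by exact_mod_cast ht.ne'
  let c : Measure M → ENNReal := fun κ => (κ V - t * μ (V \ U)) / μ (U ∩ V)
  -- the intermediate measure attached to `κ`, with the same mass on `V`
  let m : Measure M → Measure M := fun κ => mixMeasure U V μ κ t (c κ)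
  have hcm : ∀ κ : Measure M, t * μ (V \ U) < κ V →
      t * μ (V \ U) + c κ * μ (U ∩ V) = κ V := fun κ hlt => by
    rw [ENNReal.div_mul_cancel hm0 hm1, add_tsub_cancel_of_le hlt.le]
  have hgood : ∀ κ : Measure M, GoodOn Set.univ κ → t * μ (V \ U) < κ V →
      GoodOn Set.univ (m κ) := fun κ hκ hlt => by
    have := hκ.finite
    exact goodOn_mixMeasure hU hV hμ hκ ht0 ENNReal.coe_ne_top
      (ENNReal.div_pos (tsub_pos_of_lt hlt).ne' hm1).ne'
      (ENNReal.div_lt_top (ENNReal.sub_ne_top (measure_ne_top κ V)) hm0).ne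
  have hmV : ∀ κ : Measure M, t * μ (V \ U) < κ V → m κ V = κ V := fun κ hlt => by
    rw [mixMeasure_apply _ _ _ _ hVm, Set.inter_compl_self, measure_empty, zero_add,
      Set.inter_eq_self_of_subset_right Set.sdiff_subset,
      Set.inter_eq_self_of_subset_right Set.inter_subset_right, hcm κ hlt]
  have hmoff : ∀ κ : Measure M, (m κ).restrict Vᶜ = κ.restrict Vᶜ := fun κ => by
    ext A hA
    rw [Measure.restrict_apply hA, Measure.restrict_apply hA,
      mixMeasure_apply _ _ _ _ (hA.inter hVm.compl), Set.inter_assoc, Set.inter_self,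
      Set.inter_assoc, Set.inter_assoc]
    have h1 : Vᶜ ∩ (V \ U) = ∅ := by ext; simp +contextual
    have h2 : Vᶜ ∩ (U ∩ V) = ∅ := by ext; simp +contextual
    simp [h1, h2]
  have hmU : ∀ κ : Measure M, t * μ (V \ U) < κ V →
      t * μ (V \ U) + m κ U = κ (U ∪ V) := fun κ hlt => by
    have h1 : U ∩ (V \ U) = ∅ := by ext; simp +contextual
    have h2 : U ∩ (U ∩ V) = U ∩ V := Set.inter_eq_self_of_subset_right Set.inter_subset_left
    have h3 : κ (U ∪ V) = κ (U ∩ Vᶜ) + κ V := by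
      rw [← Set.sdiff_eq, ← measure_union Set.disjoint_sdiff_left hVm, Set.sdiff_union_self]
    rw [mixMeasure_apply _ _ _ _ hUm, h1, h2, h3, ← hcm κ hlt, measure_empty, mul_zero, add_zero]
    ring
  have hmoffU : (m μ).restrict Uᶜ = (m ν).restrict Uᶜ := by
    ext A hA
    have h1 : A ∩ Uᶜ ∩ (U ∩ V) = ∅ := by ext; simp +contextual
    have h2 : A ∩ Uᶜ ∩ Vᶜ = A ∩ (U ∪ V)ᶜ := by rw [Set.compl_union, Set.inter_assoc]
    have h3 := congrArg (fun κ : Measure M => κ A) hoff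
    simp only [Measure.restrict_apply hA] at h3
    rw [Measure.restrict_apply hA, Measure.restrict_apply hA,
      mixMeasure_apply _ _ _ _ (hA.inter hUm.compl), mixMeasure_apply _ _ _ _ (hA.inter hUm.compl),
      h1, h2, h3, measure_empty, mul_zero, mul_zero]
  have hltμ := htlt.trans_le (min_le_left _ _)
  have hltν := htlt.trans_le (min_le_right _ _)
  obtain ⟨f, hf, hfm⟩ := hfV μ (m μ) hμ (hgood μ hμ hltμ) (hmoff μ).symm (hmV μ hltμ).symm
  obtain ⟨g, hg, hgm⟩ := hfU (m μ) (m ν) (hgood μ hμ hltμ) (hgood ν hν hltν) hmoffU (by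
    have h1 := hmU μ hltμ
    rw [hmass, ← hmU ν hltν] at h1
    exact (ENNReal.add_right_inj (ENNReal.mul_ne_top ENNReal.coe_ne_top
      (measure_ne_top _ _))).1 h1)
  obtain ⟨k, hk, hkm⟩ := hfV (m ν) ν (hgood ν hν hltν) hν (hmoff ν) (hmV ν hltν)
  refine ⟨k.comp (g.comp f), (hf.homeoSet_comp hg).homeoSet_comp hk, ?_⟩
  rw [ContinuousMap.coe_comp, ContinuousMap.coe_comp,
    ← Measure.map_map k.continuous.measurable (g.continuous.comp f.continuous).measurable,
    ← Measure.map_map g.continuous.measurable f.continuous.measurable, hfm, hgm, hkm]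

/-- A compact connected space in which every point has a flexible open neighbourhood is
flexible. -/
lemma flexible_univ [T1Space M] [LocallyCompactSpace M] [CompactSpace M] [ConnectedSpace M]
    (h : ∀ x : M, ∃ U, IsOpen U ∧ x ∈ U ∧ Flexible U) : Flexible (Set.univ : Set M) := by
  choose U hU hxU hfU using h
  obtain ⟨s, hs⟩ := CompactSpace.elim_nhds_subcover U fun x => (hU x).mem_nhds (hxU x)
  have hcover : ∀ x, ∃ i ∈ s, x ∈ U i := fun x => by
    have : x ∈ ⋃ i ∈ s, U i := hs ▸ Set.mem_univ x
    simpa using this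
  classical
  let 𝒯 := {S ∈ s.powerset | S.Nonempty ∧ Flexible (⋃ i ∈ S, U i)}
  obtain ⟨x₀⟩ := (inferInstance : Nonempty M)
  obtain ⟨i₀, hi₀, -⟩ := hcover x₀
  have hne : 𝒯.Nonempty := ⟨{i₀}, by simp [𝒯, hi₀, hfU]⟩
  obtain ⟨S, hS⟩ := 𝒯.exists_maximal hne
  obtain ⟨hSs, ⟨j, hj⟩, hSf⟩ : S ⊆ s ∧ S.Nonempty ∧ Flexible (⋃ i ∈ S, U i) := by
    simpa [𝒯] using hS.prop
  have hWo : IsOpen (⋃ i ∈ S, U i) := isOpen_biUnion fun i _ => hU i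
  have habsorb : ∀ i ∈ s, (U i ∩ ⋃ i ∈ S, U i).Nonempty → i ∈ S := fun i hi hmeet => by
    have hmem : insert i S ∈ 𝒯 := by
      simp only [𝒯, Finset.mem_filter, Finset.mem_powerset, Finset.insert_nonempty, true_and,
        Finset.set_biUnion_insert]
      exact ⟨Finset.insert_subset hi hSs, Flexible.union (hU i) hWo hmeet (hfU i) hSf⟩
    exact hS.le_of_ge hmem (Finset.subset_insert i S) (Finset.mem_insert_self i S)
  have hWc : IsClosed (⋃ i ∈ S, U i) := by
    rw [← isOpen_compl_iff, isOpen_iff_mem_nhds]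
    intro x hx
    obtain ⟨i, hi, hxi⟩ := hcover x
    refine Filter.mem_of_superset ((hU i).mem_nhds hxi) fun y hy hyW => hx ?_
    exact Set.mem_biUnion (habsorb i hi ⟨y, hy, hyW⟩) hxi
  have hW : (⋃ i ∈ S, U i) = Set.univ :=
    IsClopen.eq_univ ⟨hWc, hWo⟩ ⟨j, Set.mem_biUnion hj (hxU j)⟩
  rwa [← hW]

end Flexible

theorem stmt15 (n : ℕ) (M : Type*) [TopologicalSpace M] [MeasurableSpace M] [BorelSpace M]
    [CompactSpace M] [ConnectedSpace M] [SeparableSpace M] [MetrizableSpace M]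
    -- `M` is an `n`-manifold without boundary:
    (hM : ∀ x : M, ∃ U : Set M, IsOpen U ∧ x ∈ U ∧
      ∃ V : Set (Fin n → ℝ), IsOpen V ∧ Nonempty (↥U ≃ₜ ↥V))
    -- `μ` and `ν` are good Radon measures on `M` with equal total mass:
    (μ ν : Measure M) [IsFiniteMeasureOnCompacts μ] [IsFiniteMeasureOnCompacts ν]
    (hμatom : ∀ p : M, μ {p} = 0) (hνatom : ∀ p : M, ν {p} = 0)
    (hμpos : ∀ U : Set M, IsOpen U → U.Nonempty → 0 < μ U)
    (hνpos : ∀ U : Set M, IsOpen U → U.Nonempty → 0 < ν U)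
    (htotal : μ Set.univ = ν Set.univ) :
    ∃ h ∈ HomeoIdComp M, Measure.map h μ = ν := by
  have hflex : Flexible (Set.univ : Set M) := by
    refine flexible_univ fun x => ?_
    obtain ⟨U, hU, hx, V, hV, ⟨e⟩⟩ := hM x
    obtain ⟨ψ, hxs, hxb, hψ⟩ := exists_unit_chart hU hx hV e
    exact ⟨_, ψ.isOpen_inter_preimage Metric.isOpen_ball, ⟨hxs, hxb⟩, flexible_chart_ball hψ⟩
  have hgood : ∀ κ : Measure M, IsFiniteMeasureOnCompacts κ → (∀ p, κ {p} = 0) →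
      (∀ U : Set M, IsOpen U → U.Nonempty → 0 < κ U) → GoodOn Set.univ κ :=
    fun κ hκ ha hp => ⟨⟨isCompact_univ.measure_lt_top⟩, ha, by simp, fun U hU hne _ => hp U hU hne⟩
  obtain ⟨h, hh, hmap⟩ := hflex μ ν (hgood μ inferInstance hμatom hμpos)
    (hgood ν inferInstance hνatom hνpos) (by simp) htotal
  have hpath := isPathConnected_pathComponentIn hh.source_mem
  exact ⟨h, hpath.isConnected.isPreconnected.subset_connectedComponentIn
    (JoinedIn.refl hh.source_mem) pathComponentIn_subset hh, hmap⟩
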